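/- arXiv:2504.21014 — 5 statements merged into one kernel-verified Lean document; each statement's English description precedes it below -/
import Mathlib

section
/- Let φ : ℂ → ℂ be entire, let λ₁, λ₂ ∈ ℂ with Im(λ₂/λ₁) > 0, and let α₁, β₁, α₂, β₂ ∈ ℂ be such that φ(z + λ₁) = e^{α₁ z + β₁} φ(z) and φ(z + λ₂) = e^{α₂ z + β₂} φ(z) for all z ∈ ℂ. Suppose (α₁ λ₂ − α₂ λ₁)/(2πi) is a nonnegative real number N and that φ has at least ⌊N⌋ + 1 zeros that are pairwise distinct modulo the lattice ℤλ₁ + ℤλ₂. Then φ is identically zero. -/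
open Complex

/-- The infinite product `∏ (1 - qⁿ w)` over `n ≥ 0`. -/
noncomputable def qProd (q w : ℂ) : ℂ := ∏' n : ℕ, (1 + -(q ^ n * w))

section qProd

variable {q : ℂ}

lemma summable_norm_neg_pow_mul (hq : ‖q‖ < 1) (w : ℂ) :
    Summable fun n : ℕ ↦ ‖-(q ^ n * w)‖ := by
  simpa using (summable_geometric_of_lt_one (norm_nonneg q) hq).mul_right ‖w‖

lemma differentiable_qProd (hq : ‖q‖ < 1) : Differentiable ℂ (qProd q) := by
  intro z
  have hs : Summable fun n : ℕ ↦ ‖q‖ ^ n * (‖z‖ + 1) :=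
    (summable_geometric_of_lt_one (norm_nonneg q) hq).mul_right _
  have hb : ∀ n : ℕ, ∀ x ∈ Metric.ball (0 : ℂ) (‖z‖ + 1),
      ‖-(q ^ n * x)‖ ≤ ‖q‖ ^ n * (‖z‖ + 1) := by
    intro n x hx
    rw [norm_neg, norm_mul, norm_pow]
    have : ‖x‖ < ‖z‖ + 1 := by simpa using hx
    gcongr
  have hloc := hs.hasProdLocallyUniformlyOn_nat_one_add Metric.isOpen_ball
    (.of_forall hb) (fun n ↦ by fun_prop)
  exact (hloc.differentiableOn (.of_forall fun _ ↦ by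
    simpa [Finset.prod_fn] using DifferentiableOn.finsetProd (fun _ _ ↦ by fun_prop))
      Metric.isOpen_ball).differentiableAt (Metric.isOpen_ball.mem_nhds (by simp))

lemma qProd_eq_mul (hq : ‖q‖ < 1) (w : ℂ) : qProd q w = (1 - w) * qProd q (q * w) := by
  have hm : Multipliable fun n : ℕ ↦ (1 + -(q ^ (n + 1) * w)) :=
    multipliable_one_add_of_summable
      ((summable_nat_add_iff 1).2 (summable_norm_neg_pow_mul hq w))
  have h := tprod_eq_zero_mul' (f := fun n : ℕ ↦ (1 + -(q ^ n * w))) hm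
  simp only [pow_zero, one_mul, ← sub_eq_add_neg, pow_succ, mul_assoc] at h
  simpa only [qProd, ← sub_eq_add_neg] using h

lemma exists_of_qProd_eq_zero (hq : ‖q‖ < 1) {w : ℂ} (h : qProd q w = 0) :
    ∃ n : ℕ, q ^ n * w = 1 := by
  by_contra! hne
  refine tprod_one_add_ne_zero_of_summable (f := fun n : ℕ ↦ -(q ^ n * w)) (fun n ↦ ?_)
    (summable_norm_neg_pow_mul hq w) h
  rw [← sub_eq_add_neg]
  exact sub_ne_zero.2 (hne n).symm

lemma qProd_self_ne_zero (hq : ‖q‖ < 1) : qProd q q ≠ 0 := by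
  intro h
  obtain ⟨n, hn⟩ := exists_of_qProd_eq_zero hq h
  rw [← pow_succ] at hn
  have := pow_lt_one₀ (norm_nonneg q) hq n.succ_ne_zero
  rw [← norm_pow, hn] at this
  simp at this

end qProd

/-- An entire function with only simple zeros divides every entire function vanishing at its
zeros. -/
lemma exists_differentiable_eq_mul {f S : ℂ → ℂ} (hf : Differentiable ℂ f)
    (hS : Differentiable ℂ S) (hsimple : ∀ z, S z = 0 → deriv S z ≠ 0)
    (hzero : ∀ z, S z = 0 → f z = 0) :
    ∃ g : ℂ → ℂ, Differentiable ℂ g ∧ ∀ z, f z = S z * g z := by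
  classical
  refine ⟨fun z ↦ if S z = 0 then deriv f z / deriv S z else f z / S z, fun p ↦ ?_, fun z ↦ ?_⟩
  · have hdf : Differentiable ℂ (dslope f p) :=
      differentiableOn_univ.1 <| (Complex.differentiableOn_dslope Filter.univ_mem (c := p)).2 hf.differentiableOn
    have hdS : Differentiable ℂ (dslope S p) :=
      differentiableOn_univ.1 <| (Complex.differentiableOn_dslope Filter.univ_mem (c := p)).2 hS.differentiableOn
    by_cases hp : S p = 0
    · have hne : dslope S p p ≠ 0 := by simpa using hsimple p hp
      refine ((hdf p).div (hdS p) hne).congr_of_eventuallyEq ?_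
      filter_upwards [(hdS p).continuousAt.eventually_ne hne] with z hz
      by_cases hzp : z = p
      · subst hzp
        simp [hp]
      · have h1 := sub_smul_dslope_of_zero hp z
        have h2 := sub_smul_dslope_of_zero (hzero p hp) z
        have h3 : z - p ≠ 0 := sub_ne_zero.2 hzp
        have h4 : S z ≠ 0 := by
          rw [← h1]
          exact smul_ne_zero h3 hz
        simp only [h4, if_false, Pi.div_apply]
        rw [← h1, ← h2, smul_eq_mul, smul_eq_mul, mul_div_mul_left _ _ h3]
    · refine ((hf p).div (hS p) hp).congr_of_eventuallyEq ?_
      filter_upwards [(hS p).continuousAt.eventually_ne hp] with z hz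
      simp [hz]
  · by_cases h : S z = 0
    · simp [h, hzero z h]
    · simp [h, mul_div_cancel₀]

/-- There is an entire function, quasi-periodic with respect to `1` and `τ`, whose zeros are simple
and are exactly the points of the lattice `ℤ + ℤτ`. -/
lemma exists_theta {τ : ℂ} (hτ : 0 < τ.im) :
    ∃ S : ℂ → ℂ, Differentiable ℂ S ∧ (∀ z, S (z + 1) = S z) ∧
      (∀ z, S (z + τ) = -exp (-(2 * Real.pi * I * z)) * S z) ∧ S 0 = 0 ∧
      (∀ z, S z = 0 → deriv S z ≠ 0) ∧ ∀ z, S z = 0 → ∃ n m : ℤ, z = n + m * τ := by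
  set q : ℂ := exp (2 * Real.pi * I * τ) with hqdef
  have hq : ‖q‖ < 1 := UpperHalfPlane.norm_exp_two_pi_I_lt_one ⟨τ, hτ⟩
  set e : ℂ → ℂ := fun z ↦ exp (2 * Real.pi * I * z) with hedef
  have he : Differentiable ℂ e := by fun_prop
  have hadd (z w : ℂ) : e (z + w) = e z * e w := by
    simp only [hedef, ← Complex.exp_add]; ring_nf
  have hint (n : ℤ) : e n = 1 := Complex.exp_eq_one_iff.2 ⟨n, by ring⟩
  have heq (z : ℂ) (h : e z = 1) : ∃ n : ℤ, z = n := by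
    obtain ⟨n, hn⟩ := Complex.exp_eq_one_iff.1 h
    exact ⟨n, mul_left_cancel₀ two_pi_I_ne_zero (by rw [hn]; ring)⟩
  have hpow (n : ℕ) : q ^ n = e (n * τ) := by
    rw [hqdef, ← Complex.exp_nat_mul]; simp only [hedef]; ring_nf
  have hEd := differentiable_qProd hq
  set S : ℂ → ℂ := fun z ↦ qProd q (e z) * qProd q (q * e (-z)) with hS
  have hSd : Differentiable ℂ S := by
    have h1 : Differentiable ℂ fun z ↦ qProd q (e z) := hEd.comp he
    have h2 : Differentiable ℂ fun z ↦ qProd q (q * e (-z)) :=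
      hEd.comp (by fun_prop : Differentiable ℂ fun z ↦ q * e (-z))
    exact h1.mul h2
  have hS1 (z : ℂ) : S (z + 1) = S z := by
    have h1 : e 1 = 1 := by simpa using hint 1
    have h2 : e (-1) = 1 := by simpa using hint (-1)
    simp only [hS, neg_add, hadd, h1, h2, mul_one]
  have hSτ (z : ℂ) : S (z + τ) = -exp (-(2 * Real.pi * I * z)) * S z := by
    have h1 : e (z + τ) = q * e z := by rw [hadd, mul_comm]
    have h2 : q * e (-(z + τ)) = e (-z) := by
      change e τ * _ = _
      rw [← hadd]; congr 1; ring
    have h3 : exp (-(2 * Real.pi * I * z)) = e (-z) := by simp only [hedef]; ring_nf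
    have h4 : e (-z) * e z = 1 := by rw [← hadd]; simpa using hint 0
    simp only [hS]
    rw [h1, h2, h3, qProd_eq_mul hq (e z), qProd_eq_mul hq (e (-z))]
    linear_combination (-qProd q (q * e z) * qProd q (q * e (-z))) * h4
  have hS0 : S 0 = 0 := by
    have : e 0 = 1 := by simpa using hint 0
    simp [hS, this, qProd_eq_mul hq 1]
  have hlat (z : ℂ) (hz : S z = 0) : ∃ n m : ℤ, z = n + m * τ := by
    rcases mul_eq_zero.1 hz with h | h
    · obtain ⟨n, hn⟩ := exists_of_qProd_eq_zero hq h
      rw [hpow, ← hadd] at hn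
      obtain ⟨k, hk⟩ := heq _ hn
      exact ⟨k, -n, by push_cast; linear_combination hk⟩
    · obtain ⟨n, hn⟩ := exists_of_qProd_eq_zero hq h
      rw [← mul_assoc, ← pow_succ, hpow, ← hadd] at hn
      obtain ⟨k, hk⟩ := heq _ hn
      exact ⟨-k, n + 1, by push_cast at hk ⊢; linear_combination -hk⟩
  have hder0 : deriv S 0 ≠ 0 := by
    set H : ℂ → ℂ := fun z ↦ qProd q (q * e z) * qProd q (q * e (-z)) with hH
    have hHd : Differentiable ℂ H := by
      have h1 : Differentiable ℂ fun z ↦ qProd q (q * e z) :=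
        hEd.comp (by fun_prop : Differentiable ℂ fun z ↦ q * e z)
      have h2 : Differentiable ℂ fun z ↦ qProd q (q * e (-z)) :=
        hEd.comp (by fun_prop : Differentiable ℂ fun z ↦ q * e (-z))
      exact h1.mul h2
    have hSH : S = fun z ↦ (1 - e z) * H z := by
      funext z
      simp only [hS, hH]
      rw [qProd_eq_mul hq (e z), mul_assoc]
    have hed : HasDerivAt e (2 * Real.pi * I) 0 := by
      simpa [hedef] using ((hasDerivAt_id (0 : ℂ)).const_mul (2 * Real.pi * I)).cexp
    have he0 : e 0 = 1 := by simpa using hint 0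
    rw [hSH, ((hed.const_sub 1).fun_mul (hHd 0).hasDerivAt).deriv]
    simp [he0, hH, Real.pi_ne_zero, qProd_self_ne_zero hq]
  have hdS1 (z : ℂ) : deriv S (z + 1) = deriv S z := by
    rw [← deriv_comp_add_const, funext hS1]
  have hdSτ (z : ℂ) (hz : S z = 0) :
      deriv S (z + τ) = -exp (-(2 * Real.pi * I * z)) * deriv S z := by
    rw [← deriv_comp_add_const, funext hSτ, deriv_fun_mul (by fun_prop) (hSd z), hz]
    simp
  have hP1 : Function.Periodic (fun z ↦ S z = 0 ∧ deriv S z = 0) 1 := fun z ↦ by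
    simp only [hS1, hdS1]
  have hPτ : Function.Periodic (fun z ↦ S z = 0 ∧ deriv S z = 0) τ := fun z ↦ by
    by_cases hz : S z = 0
    · simp [hSτ, hdSτ z hz]
    · simp [hSτ, hz]
  refine ⟨S, hSd, hS1, hSτ, hS0, fun z hz hd ↦ hder0 ?_, hlat⟩
  obtain ⟨n, m, rfl⟩ := hlat z hz
  have h1 := hPτ.int_mul m (n : ℂ)
  have h2 := hP1.int_mul n 0
  simp only [mul_one, zero_add] at h1 h2
  exact (h2.mp (h1.mp ⟨hz, hd⟩)).2

lemma exists_forall_le_of_periodic {h : ℂ → ℝ} (hc : Continuous h) {τ : ℂ} (hτ : 0 < τ.im)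
    (h1 : Function.Periodic h 1) (h2 : Function.Periodic h τ) : ∃ M, ∀ z, h z ≤ M := by
  have hK : IsCompact ((fun p : ℝ × ℝ ↦ (p.1 + p.2 * τ : ℂ)) '' (Set.Icc 0 1 ×ˢ Set.Icc 0 1)) :=
    (isCompact_Icc.prod isCompact_Icc).image (by fun_prop)
  obtain ⟨M, hM⟩ := hK.bddAbove_image hc.continuousOn
  refine ⟨M, fun z ↦ ?_⟩
  set y : ℝ := z.im / τ.im with hy
  set x : ℝ := z.re - y * τ.re with hx
  have hz : z = x + y * τ := by
    apply Complex.ext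
    · simp [hx]
    · simp [hy, hτ.ne']
  have hfr : z - ⌊y⌋ * τ - ⌊x⌋ * 1 = (Int.fract x : ℝ) + (Int.fract y : ℝ) * τ := by
    simp only [Int.fract]
    push_cast
    linear_combination hz
  rw [← h2.sub_int_mul_eq ⌊y⌋, ← h1.sub_int_mul_eq ⌊x⌋, hfr]
  refine hM ⟨_, ⟨(Int.fract x, Int.fract y), ?_, rfl⟩, rfl⟩
  exact ⟨⟨Int.fract_nonneg _, (Int.fract_lt_one _).le⟩,
    ⟨Int.fract_nonneg _, (Int.fract_lt_one _).le⟩⟩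

lemma eq_zero_of_quasiPeriodic_of_neg {f : ℂ → ℂ} (hf : Differentiable ℂ f) {τ : ℂ}
    (hτ : 0 < τ.im) {α₁ β₁ α₂ β₂ : ℂ} (h1 : ∀ z, f (z + 1) = exp (α₁ * z + β₁) * f z)
    (h2 : ∀ z, f (z + τ) = exp (α₂ * z + β₂) * f z) {N : ℝ} (hN : N < 0)
    (hNval : α₁ * τ - α₂ = 2 * Real.pi * I * N) (z : ℂ) : f z = 0 := by
  set c : ℝ := Real.pi * N / τ.im with hc
  have hcneg : c < 0 := div_neg_of_neg_of_pos (mul_neg_of_pos_of_neg Real.pi_pos hN) hτ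
  have hcτ : c * τ.im = Real.pi * N := by rw [hc]; field_simp
  set r : ℝ := (β₁ - α₁ / 2).re with hr
  set s : ℝ := ((α₁ / 2 * τ ^ 2).re + r * τ.re + c * τ.im ^ 2 - β₂.re) / τ.im with hs
  have hsτ : s * τ.im = (α₁ / 2 * τ ^ 2).re + r * τ.re + c * τ.im ^ 2 - β₂.re := by
    rw [hs]; field_simp
  set Q : ℂ → ℂ := fun z ↦ α₁ / 2 * z ^ 2 + (r + s * I) * z with hQ
  set R : ℂ → ℝ := fun z ↦ (Q z).re + c * z.im ^ 2 with hR
  have hR1 (z : ℂ) : R (z + 1) = R z + (α₁ * z + β₁).re := by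
    have e : Q (z + 1) = Q z + (α₁ * z + (α₁ / 2 + (r + s * I))) := by simp only [hQ]; ring
    simp only [hR, e, add_re, hr, sub_re, ofReal_re, mul_re, ofReal_im, I_re, I_im, add_im, one_im]
    ring
  have hR2 (z : ℂ) : R (z + τ) = R z + (α₂ * z + β₂).re := by
    have e : Q (z + τ) = Q z + ((α₂ * z + (Real.pi * N : ℝ) * (2 * I * z)) +
        (α₁ / 2 * τ ^ 2 + (r + s * I) * τ)) := by
      simp only [hQ]; push_cast; linear_combination z * hNval
    have e1 : ((Real.pi * N : ℝ) * (2 * I * z)).re = -(2 * (c * τ.im) * z.im) := by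
      rw [hcτ]; simp; ring
    have e2 : ((r + s * I) * τ).re = r * τ.re - s * τ.im := by simp
    simp only [hR, e, add_re, e1, e2, add_im]
    rw [hsτ]
    ring
  have hfc := hf.continuous
  obtain ⟨M, hM⟩ : ∃ M, ∀ z, ‖f z‖ * Real.exp (-R z) ≤ M := by
    refine exists_forall_le_of_periodic (by fun_prop) hτ (fun z ↦ ?_) (fun z ↦ ?_)
    · simp only [h1, hR1, norm_mul, norm_exp, neg_add, Real.exp_add, Real.exp_neg]
      field_simp
    · simp only [h2, hR2, norm_mul, norm_exp, neg_add, Real.exp_add, Real.exp_neg]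
      field_simp
  have hbound (z : ℂ) : ‖f z * exp (-Q z)‖ ≤ M * Real.exp (c * z.im ^ 2) := by
    have e : ‖f z * exp (-Q z)‖ = ‖f z‖ * Real.exp (-R z) * Real.exp (c * z.im ^ 2) := by
      rw [norm_mul, norm_exp, mul_assoc, ← Real.exp_add]
      simp [hR]
    rw [e]
    gcongr
    exact hM z
  have hM0 : 0 ≤ M := le_trans (by positivity) (hM 0)
  have hd : Differentiable ℂ fun z ↦ f z * exp (-Q z) := by fun_prop
  obtain ⟨k, hk⟩ := hd.exists_const_forall_eq_of_bounded (isBounded_iff_forall_norm_le.2 ⟨M, by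
    rintro _ ⟨z, rfl⟩
    refine (hbound z).trans (mul_le_of_le_one_right hM0 (Real.exp_le_one_iff.2 ?_))
    exact mul_nonpos_of_nonpos_of_nonneg hcneg.le (sq_nonneg _)⟩)
  have hlim : Filter.Tendsto (fun y : ℝ ↦ M * Real.exp (c * y ^ 2)) Filter.atTop (nhds 0) := by
    rw [← mul_zero M]
    exact (Real.tendsto_exp_atBot.comp
      ((Filter.tendsto_pow_atTop two_ne_zero).const_mul_atTop_of_neg hcneg)).const_mul M
  have hk0 : ‖k‖ ≤ 0 := ge_of_tendsto' hlim fun y ↦ by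
    simpa [hk] using hbound (y * I)
  have := hk z
  rw [norm_le_zero_iff.1 hk0] at this
  simpa [exp_ne_zero] using this

lemma eq_of_mul_left_eq {S f g : ℂ → ℂ} (hS : Differentiable ℂ S) (hf : Differentiable ℂ f)
    (hg : Differentiable ℂ g) (hS0 : ∃ z, S z ≠ 0) (h : ∀ z, S z * f z = S z * g z) (z : ℂ) :
    f z = g z := by
  have han {u : ℂ → ℂ} (hu : Differentiable ℂ u) : AnalyticOnNhd ℂ u Set.univ :=
    hu.differentiableOn.analyticOnNhd isOpen_univ
  rcases (han hS).eq_zero_or_eq_zero_of_mul_eq_zero (han (hf.sub hg))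
    (fun w _ ↦ by simp [mul_sub, h w]) isPreconnected_univ with h0 | h0
  · obtain ⟨w, hw⟩ := hS0
    exact absurd (h0 w trivial) hw
  · exact sub_eq_zero.1 (h0 z trivial)

lemma eq_zero_of_quasiPeriodic_of_zeros {τ : ℂ} (hτ : 0 < τ.im) (n : ℕ) {f : ℂ → ℂ}
    (hf : Differentiable ℂ f) {α₁ β₁ α₂ β₂ : ℂ}
    (h1 : ∀ z, f (z + 1) = exp (α₁ * z + β₁) * f z)
    (h2 : ∀ z, f (z + τ) = exp (α₂ * z + β₂) * f z) {N : ℝ} (hN : N < n)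
    (hNval : α₁ * τ - α₂ = 2 * Real.pi * I * N) {zs : Fin n → ℂ} (hzero : ∀ i, f (zs i) = 0)
    (hdist : ∀ i j, i ≠ j → ¬∃ k m : ℤ, zs i - zs j = k + m * τ) (z : ℂ) : f z = 0 := by
  induction n generalizing f α₁ β₁ α₂ β₂ N z with
  | zero => exact eq_zero_of_quasiPeriodic_of_neg hf hτ h1 h2 (by simpa using hN) hNval z
  | succ n ih =>
    obtain ⟨S, hSd, hS1, hSτ, hS0, hSsimple, hSlat⟩ := exists_theta hτ
    set p := zs 0 with hp
    have hP1 : Function.Periodic (fun z ↦ f z = 0) 1 := fun z ↦ by simp [h1, exp_ne_zero]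
    have hPτ : Function.Periodic (fun z ↦ f z = 0) τ := fun z ↦ by simp [h2, exp_ne_zero]
    have hTd : Differentiable ℂ fun z ↦ S (z - p) := hSd.comp (by fun_prop)
    obtain ⟨g, hg, hfg⟩ := exists_differentiable_eq_mul hf hTd
      (fun z hz ↦ by rw [deriv_comp_sub_const]; exact hSsimple _ hz) (fun z hz ↦ by
        obtain ⟨k, m, hkm⟩ := hSlat _ hz
        have e1 := hP1.int_mul k p
        have e2 := hPτ.int_mul m (p + k * 1)
        rw [show p + k * 1 + m * τ = z by linear_combination -hkm] at e2
        exact e2.mpr (e1.mpr (hzero 0)))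
    have hTne : ∃ z, S (z - p) ≠ 0 := by
      by_contra! hall
      refine hSsimple 0 hS0 ?_
      rw [show S = fun _ ↦ 0 from funext fun z ↦ by simpa using hall (z + p)]
      simp
    have hg1 : ∀ z, g (z + 1) = exp (α₁ * z + β₁) * g z := by
      refine eq_of_mul_left_eq hTd (hg.comp (by fun_prop : Differentiable ℂ fun z : ℂ ↦ z + 1))
        (by fun_prop) hTne fun z ↦ ?_
      have := h1 z
      rw [hfg, hfg, show z + 1 - p = z - p + 1 by ring, hS1] at this
      linear_combination this
    have hg2 : ∀ z, g (z + τ) = exp ((α₂ + 2 * Real.pi * I) * z +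
        (β₂ - 2 * Real.pi * I * p + Real.pi * I)) * g z := by
      refine eq_of_mul_left_eq hTd (hg.comp (by fun_prop : Differentiable ℂ fun z : ℂ ↦ z + τ))
        (by fun_prop) hTne fun z ↦ ?_
      have := h2 z
      rw [hfg, hfg, show z + τ - p = z - p + τ by ring, hSτ] at this
      have hE : exp ((α₂ + 2 * Real.pi * I) * z + (β₂ - 2 * Real.pi * I * p + Real.pi * I)) =
          -(exp (α₂ * z + β₂) * exp (2 * Real.pi * I * (z - p))) := by
        rw [← exp_add, ← mul_neg_one, ← exp_pi_mul_I, ← exp_add]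
        ring_nf
      have hinv : exp (2 * Real.pi * I * (z - p)) * exp (-(2 * Real.pi * I * (z - p))) = 1 := by
        rw [← exp_add, add_neg_cancel, exp_zero]
      rw [hE]
      linear_combination (-exp (2 * Real.pi * I * (z - p))) * this -
        (S (z - p) * g (z + τ)) * hinv
    rw [hfg, ih (N := N - 1) (zs := fun i ↦ zs i.succ) hg hg1 hg2
      (by push_cast at hN; linarith) (by push_cast; linear_combination hNval) (fun i ↦ ?_)
      (fun i j hij ↦ hdist _ _ (by simpa using hij)) z, mul_zero]
    refine (mul_eq_zero.1 ((hfg _).symm.trans (hzero i.succ))).resolve_left fun h ↦ ?_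
    exact hdist _ _ (Fin.succ_ne_zero i) (hSlat _ h)

/-- An entire quasi-periodic function whose zero count
`N = (α₁ λ₂ − α₂ λ₁)/(2πi)` is a nonnegative real number and which has at least `⌊N⌋ + 1`
zeros that are pairwise distinct modulo the lattice `ℤλ₁ + ℤλ₂` is identically zero. -/
theorem quasiPeriodic_eq_zero_of_many_zeros
    (φ : ℂ → ℂ) (hφ : Differentiable ℂ φ)
    (lam₁ lam₂ : ℂ) (hIm : 0 < (lam₂ / lam₁).im)
    (α₁ β₁ α₂ β₂ : ℂ)
    (hqp₁ : ∀ z : ℂ, φ (z + lam₁) = Complex.exp (α₁ * z + β₁) * φ z)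
    (hqp₂ : ∀ z : ℂ, φ (z + lam₂) = Complex.exp (α₂ * z + β₂) * φ z)
    (N : ℝ) (hN : 0 ≤ N)
    (hNval : (α₁ * lam₂ - α₂ * lam₁) / (2 * Real.pi * Complex.I) = (N : ℂ))
    (zs : Fin (Nat.floor N + 1) → ℂ)
    (hzero : ∀ i, φ (zs i) = 0)
    (hdist : ∀ i j, i ≠ j → ¬∃ n m : ℤ, zs i - zs j = (n : ℂ) * lam₁ + (m : ℂ) * lam₂) :
    ∀ z : ℂ, φ z = 0 := by
  have hl : lam₁ ≠ 0 := by
    rintro rfl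
    simp at hIm
  have hτ : lam₁ * (lam₂ / lam₁) = lam₂ := mul_div_cancel₀ _ hl
  have hNval' := (div_eq_iff two_pi_I_ne_zero).1 hNval
  intro z
  have key := eq_zero_of_quasiPeriodic_of_zeros (f := fun z ↦ φ (lam₁ * z)) (α₁ := α₁ * lam₁)
    (β₁ := β₁) (α₂ := α₂ * lam₁) (β₂ := β₂) (zs := fun i ↦ zs i / lam₁) (N := N) hIm
    (Nat.floor N + 1) (hφ.comp (by fun_prop : Differentiable ℂ fun z ↦ lam₁ * z))
    (fun z ↦ by rw [mul_add, mul_one, hqp₁, mul_assoc])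
    (fun z ↦ by rw [mul_add, hτ, hqp₂, mul_assoc])
    (by exact_mod_cast Nat.lt_floor_add_one N)
    (by linear_combination hNval' + α₁ * hτ)
    (fun i ↦ by simpa [mul_div_cancel₀ _ hl] using hzero i)
    (fun i j hij ⟨n, m, h⟩ ↦ hdist i j hij ⟨n, m, by
      rw [← sub_div, div_eq_iff hl] at h
      linear_combination h + m * hτ⟩) (z / lam₁)
  simpa [mul_div_cancel₀ _ hl] using key
end

section
/- For every z, a, b, c ∈ ℂ, one has σ(z+a)σ(z−a)σ(b+c)σ(b−c) + σ(z+b)σ(z−b)σ(c+a)σ(c−a) + σ(z+c)σ(z−c)σ(a+b)σ(a−b) = 0 (the Weierstrass three-term identity). -/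
open Complex

/-- The lattice point `2nω₁ + 2mω₃` associated to `(n, m) ∈ ℤ²`. -/
noncomputable def latticePoint (ω₁ ω₃ : ℂ) (p : ℤ × ℤ) : ℂ :=
  2 * (p.1 : ℂ) * ω₁ + 2 * (p.2 : ℂ) * ω₃

/-- The Weierstrass sigma function with half-periods `ω₁, ω₃`,
`σ(z) = z ∏_{(n,m)≠(0,0)} (1 − z/w) exp(z/w + z²/(2w²))` with `w = 2nω₁ + 2mω₃`. -/
noncomputable def wSigma (ω₁ ω₃ z : ℂ) : ℂ :=
  z * ∏' p : {p : ℤ × ℤ // p ≠ (0, 0)},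
    (1 - z / latticePoint ω₁ ω₃ p.1) *
      Complex.exp (z / latticePoint ω₁ ω₃ p.1 + z ^ 2 / (2 * (latticePoint ω₁ ω₃ p.1) ^ 2))

/-- The Weierstrass primary factor of genus two attached to the point `l`; it is `1` for `l = 0`. -/
noncomputable def sigmaFactor (l z : ℂ) : ℂ :=
  (1 - z / l) * exp (z / l + z ^ 2 / (2 * l ^ 2))

@[simp]
lemma sigmaFactor_zero_left (z : ℂ) : sigmaFactor 0 z = 1 := by simp [sigmaFactor]

lemma sigmaFactor_zero_right (l : ℂ) : sigmaFactor l 0 = 1 := by simp [sigmaFactor]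

lemma sigmaFactor_neg (l z : ℂ) : sigmaFactor (-l) (-z) = sigmaFactor l z := by
  simp [sigmaFactor]

lemma differentiable_sigmaFactor (l : ℂ) : Differentiable ℂ (sigmaFactor l) := by
  unfold sigmaFactor
  fun_prop

lemma sigmaFactor_ne_zero {l z : ℂ} (h : z ≠ l ∨ l = 0) : sigmaFactor l z ≠ 0 := by
  rcases eq_or_ne l 0 with rfl | hl
  · simp
  have hz : z ≠ l := h.resolve_right hl
  refine mul_ne_zero (fun e ↦ hz ?_) (exp_ne_zero _)
  field_simp at e
  linear_combination -e

lemma norm_one_sub_mul_exp_sub_one_le {u : ℂ} (hu : ‖u‖ ≤ 1) :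
    ‖(1 - u) * exp (u + u ^ 2 / 2) - 1‖ ≤ Real.exp 2 * ‖u‖ ^ 3 := by
  have hd (x : ℂ) : HasDerivAt (fun u : ℂ ↦ (1 - u) * exp (u + u ^ 2 / 2))
      (-x ^ 2 * exp (x + x ^ 2 / 2)) x := by
    have h1 : HasDerivAt (fun u : ℂ ↦ 1 - u) (-1) x := (hasDerivAt_id x).const_sub 1
    have h2 : HasDerivAt (fun u : ℂ ↦ u + u ^ 2 / 2) (1 + x) x := by
      convert! (hasDerivAt_id x).add ((hasDerivAt_pow 2 x).div_const 2) using 1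
      simp
    convert! h1.mul h2.cexp using 1
    ring
  have hb (x : ℂ) (hx : x ∈ Metric.closedBall (0 : ℂ) ‖u‖) :
      ‖-x ^ 2 * exp (x + x ^ 2 / 2)‖ ≤ Real.exp 2 * ‖u‖ ^ 2 := by
    rw [mem_closedBall_zero_iff] at hx
    have hx1 : ‖x‖ ≤ 1 := hx.trans hu
    have h1 : (x + x ^ 2 / 2).re ≤ 2 := by
      refine (re_le_norm _).trans ((norm_add_le _ _).trans ?_)
      simp only [norm_div, norm_pow, norm_ofNat]
      nlinarith [norm_nonneg x]
    rw [norm_mul, norm_neg, norm_pow, norm_exp, mul_comm]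
    gcongr
  have := (convex_closedBall (0 : ℂ) ‖u‖).norm_image_sub_le_of_norm_hasDerivWithin_le
    (fun x _ ↦ (hd x).hasDerivWithinAt) hb (x := 0) (y := u) (by simp) (by simp)
  simp only [sub_zero, one_mul, add_zero, ne_eq, OfNat.ofNat_ne_zero, not_false_eq_true, zero_pow,
    zero_div, exp_zero] at this
  linarith [this, pow_succ ‖u‖ 2]

lemma norm_sigmaFactor_sub_one_le {l z : ℂ} {r : ℝ} (hz : ‖z‖ ≤ r) (hl : r ≤ ‖l‖) :
    ‖sigmaFactor l z - 1‖ ≤ Real.exp 2 * r ^ 3 * ‖l‖ ^ (-3 : ℝ) := by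
  have hu : ‖z / l‖ ≤ r / ‖l‖ := by
    rw [norm_div]
    gcongr
  have h := norm_one_sub_mul_exp_sub_one_le (hu.trans (div_le_one_of_le₀ hl (norm_nonneg l)))
  have h2 : sigmaFactor l z = (1 - z / l) * exp (z / l + (z / l) ^ 2 / 2) := by
    rw [sigmaFactor, div_pow, div_div, mul_comm 2]
  rw [h2]
  refine h.trans ?_
  calc _ ≤ Real.exp 2 * (r / ‖l‖) ^ 3 := by gcongr
    _ = Real.exp 2 * r ^ 3 * (‖l‖ ^ 3)⁻¹ := by rw [div_pow]; ring
    _ = _ := by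
      rw [Real.rpow_neg (norm_nonneg l)]
      norm_cast

lemma logDeriv_sigmaFactor {l z : ℂ} (hz : z ≠ l ∨ l = 0) :
    logDeriv (sigmaFactor l) z = if l = 0 then 0 else 1 / (z - l) + 1 / l + z / l ^ 2 := by
  split_ifs with hl
  · subst hl
    rw [show sigmaFactor 0 = fun _ ↦ 1 from funext sigmaFactor_zero_left, logDeriv_const]
    rfl
  have hz : z - l ≠ 0 := sub_ne_zero.mpr (hz.resolve_right hl)
  have hz' : l - z ≠ 0 := by rwa [← neg_ne_zero, neg_sub]
  have h1 : HasDerivAt (fun u : ℂ ↦ 1 - u / l) (-(1 / l)) z :=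
    ((hasDerivAt_id z).div_const l).const_sub 1
  have h2 : HasDerivAt (fun u : ℂ ↦ u / l + u ^ 2 / (2 * l ^ 2)) (1 / l + z / l ^ 2) z := by
    convert! ((hasDerivAt_id z).div_const l).add ((hasDerivAt_pow 2 z).div_const (2 * l ^ 2))
      using 1
    simp
    field
  have h3 : HasDerivAt (sigmaFactor l) _ z := h1.mul h2.cexp
  have h4 : 1 - z / l ≠ 0 := by
    rw [one_sub_div hl]
    exact div_ne_zero hz' hl
  rw [logDeriv_apply, h3.deriv, sigmaFactor]
  have := exp_ne_zero (z / l + z ^ 2 / (2 * l ^ 2))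
  field_simp
  ring

namespace PeriodPair

open Filter Topology

variable (L : PeriodPair)

lemma eventually_cofinite_le_norm (r : ℝ) : ∀ᶠ l : L.lattice in cofinite, r ≤ ‖(l : ℂ)‖ := by
  refine (isCompact_iff_finite.mp (isCompact_closedBall (0 : L.lattice) r)).subset fun l hl ↦ ?_
  simpa using (not_le.mp (Set.mem_compl_iff _ _ |>.mp hl)).le

lemma summable_norm_rpow_neg_three : Summable fun l : L.lattice ↦ ‖(l : ℂ)‖ ^ (-3 : ℝ) :=
  ZLattice.summable_norm_rpow _ _ (by simp; norm_num)

lemma countable_lattice : (L.lattice : Set ℂ).Countable :=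
  countable_of_Lindelof_of_discrete (X := L.lattice)

lemma dense_compl_lattice : Dense (L.lattice : Set ℂ)ᶜ :=
  L.countable_lattice.dense_compl ℂ

lemma isPreconnected_compl_lattice : IsPreconnected (L.lattice : Set ℂ)ᶜ :=
  (L.countable_lattice.isConnected_compl_of_one_lt_rank (by simp)).isPreconnected

/-- The canonical product over the nonzero lattice points. -/
noncomputable def sigmaProd (z : ℂ) : ℂ := ∏' l : L.lattice, sigmaFactor l z

/-- The Weierstrass sigma function of a period pair. -/
noncomputable def sigma (z : ℂ) : ℂ := z * L.sigmaProd z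

lemma hasProdLocallyUniformlyOn_sigmaProd (r : ℝ) :
    HasProdLocallyUniformlyOn (fun (l : L.lattice) z ↦ sigmaFactor l z) L.sigmaProd
      (Metric.ball 0 r) := by
  have := Summable.hasProdLocallyUniformlyOn_one_add (K := Metric.ball (0 : ℂ) r)
    (f := fun (l : L.lattice) z ↦ sigmaFactor l z - 1) Metric.isOpen_ball
    (L.summable_norm_rpow_neg_three.mul_left (Real.exp 2 * r ^ 3)) ?_ ?_
  · simpa [sigmaProd] using! this
  · filter_upwards [L.eventually_cofinite_le_norm r] with l hl z hz
    exact norm_sigmaFactor_sub_one_le (by simpa using (mem_ball_zero_iff.mp hz).le) hl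
  · exact fun l ↦ ((differentiable_sigmaFactor l).continuous.sub continuous_const).continuousOn

lemma differentiable_sigmaProd : Differentiable ℂ L.sigmaProd := by
  intro z
  have hz : z ∈ Metric.ball (0 : ℂ) (‖z‖ + 1) := by simp
  have h := hasProdLocallyUniformlyOn_iff_tendstoLocallyUniformlyOn.mp
    (L.hasProdLocallyUniformlyOn_sigmaProd (‖z‖ + 1))
  refine (h.differentiableOn (.of_forall fun s ↦ ?_) Metric.isOpen_ball).differentiableAt
    (Metric.isOpen_ball.mem_nhds hz)
  exact .fun_finsetProd fun l _ ↦ (differentiable_sigmaFactor l).differentiableOn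

lemma sigmaProd_zero : L.sigmaProd 0 = 1 := by
  simp [sigmaProd, sigmaFactor_zero_right]

lemma sigmaProd_ne_zero {z : ℂ} (hz : z ∉ L.lattice) : L.sigmaProd z ≠ 0 := by
  have := tprod_one_add_ne_zero_of_summable (f := fun l : L.lattice ↦ sigmaFactor l z - 1) ?_ ?_
  · simpa [sigmaProd] using this
  · intro l
    simpa using sigmaFactor_ne_zero (z := z) (l := l) (.inl fun h ↦ hz (h ▸ l.2))
  · refine (L.summable_norm_rpow_neg_three.mul_left (Real.exp 2 * ‖z‖ ^ 3))
      |>.of_norm_bounded_eventually ?_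
    filter_upwards [L.eventually_cofinite_le_norm ‖z‖] with l hl
    simpa using norm_sigmaFactor_sub_one_le le_rfl hl

lemma summable_logDeriv_sigmaFactor (z : ℂ) :
    Summable fun l : L.lattice ↦
      if (l : ℂ) = 0 then 0 else 1 / (z - l) + 1 / (l : ℂ) + z / (l : ℂ) ^ 2 := by
  refine (L.summable_norm_rpow_neg_three.mul_left (2 * ‖z‖ ^ 2)).of_norm_bounded_eventually ?_
  filter_upwards [L.eventually_cofinite_le_norm (2 * ‖z‖)] with l hl
  split_ifs with h
  · simp [h]
  have hl0 : 0 < ‖(l : ℂ)‖ := norm_pos_iff.mpr h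
  have hzl : ‖(l : ℂ)‖ / 2 ≤ ‖z - l‖ := by
    rw [norm_sub_rev]
    linarith [norm_sub_norm_le (l : ℂ) z]
  have hzl0 : z - l ≠ 0 := norm_pos_iff.mp (by linarith)
  have : 1 / (z - l) + 1 / (l : ℂ) + z / (l : ℂ) ^ 2 = z ^ 2 / ((z - l) * l ^ 2) := by
    field
  rw [this, norm_div, norm_mul, norm_pow, norm_pow, Real.rpow_neg (norm_nonneg _)]
  rw [show ‖(l : ℂ)‖ ^ (3 : ℝ) = ‖(l : ℂ)‖ ^ 3 by norm_cast, ← div_eq_mul_inv]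
  calc _ ≤ ‖z‖ ^ 2 / (‖(l : ℂ)‖ / 2 * ‖(l : ℂ)‖ ^ 2) := by gcongr
    _ = _ := by field

lemma logDeriv_sigmaProd {z : ℂ} (hz : z ∉ L.lattice) :
    logDeriv L.sigmaProd z = ∑' l : L.lattice,
      if (l : ℂ) = 0 then 0 else 1 / (z - l) + 1 / (l : ℂ) + z / (l : ℂ) ^ 2 := by
  have hne (l : L.lattice) : z ≠ l ∨ (l : ℂ) = 0 := .inl fun h ↦ hz (h ▸ l.2)
  have hsum := (L.summable_logDeriv_sigmaFactor z).congr
    fun l ↦ (logDeriv_sigmaFactor (hne l)).symm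
  refine (logDeriv_tprod_eq_tsum Metric.isOpen_ball (x := z) (s := Metric.ball 0 (‖z‖ + 1))
    (by simp) (fun l ↦ sigmaFactor_ne_zero (hne l))
    (fun l ↦ (differentiable_sigmaFactor l).differentiableOn) hsum
    ⟨_, L.hasProdLocallyUniformlyOn_sigmaProd _⟩ (L.sigmaProd_ne_zero hz)).trans ?_
  exact tsum_congr fun l ↦ logDeriv_sigmaFactor (hne l)

lemma differentiable_sigma : Differentiable ℂ L.sigma :=
  differentiable_id.mul L.differentiable_sigmaProd

lemma sigma_ne_zero {z : ℂ} (hz : z ∉ L.lattice) : L.sigma z ≠ 0 :=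
  mul_ne_zero (fun h ↦ hz (h ▸ zero_mem _)) (L.sigmaProd_ne_zero hz)

lemma sigma_zero : L.sigma 0 = 0 := by simp [sigma]

lemma hasDerivAt_sigma_zero : HasDerivAt L.sigma 1 0 := by
  have := (hasDerivAt_id (0 : ℂ)).mul (L.differentiable_sigmaProd 0).hasDerivAt
  simpa [sigmaProd_zero] using! this

lemma sigma_neg (z : ℂ) : L.sigma (-z) = -L.sigma z := by
  rw [sigma, sigma, neg_mul, sigmaProd, ← (Equiv.neg L.lattice).tprod_eq]
  simp [sigmaFactor_neg, sigmaProd]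

open scoped PeriodPair in
lemma hasDerivAt_logDeriv_sigma {z : ℂ} (hz : z ∉ L.lattice) :
    HasDerivAt (logDeriv L.sigma) (-L.weierstrassP z) z := by
  have hopen := L.isClosed_lattice.isOpen_compl
  have hsum : HasDerivAt (fun z ↦ ∑' l : L.lattice,
      if (l : ℂ) = 0 then 0 else 1 / (z - l) + 1 / (l : ℂ) + z / (l : ℂ) ^ 2)
      (-L.weierstrassPExcept 0 z) z := by
    refine hasDerivAt_of_tendstoLocallyUniformlyOn hopen (l := atTop)
      (f' := fun (s : Finset L.lattice) z ↦ ∑ l ∈ s,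
        -if (l : ℂ) = 0 then 0 else 1 / (z - l) ^ 2 - 1 / (l : ℂ) ^ 2)
      (g' := -L.weierstrassPExcept 0) ?_ (.of_forall fun s w hw ↦ ?_)
      (fun w _ ↦ (L.summable_logDeriv_sigmaFactor w).hasSum) hz
    · simp_rw [Finset.sum_neg_distrib]
      exact ((L.hasSumLocallyUniformly_weierstrassPExcept 0).hasSumLocallyUniformlyOn
        |> hasSumLocallyUniformlyOn_iff_tendstoLocallyUniformlyOn.mp).neg
    · refine .fun_sum fun l _ ↦ ?_
      by_cases hl : (l : ℂ) = 0
      · simpa only [if_pos hl, neg_zero] using hasDerivAt_const w (0 : ℂ)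
      simp only [if_neg hl]
      have hwl : w - l ≠ 0 := fun h ↦ hw (sub_eq_zero.mp h ▸ l.2)
      have h1 := (((hasDerivAt_id w).sub_const (l : ℂ)).fun_inv hwl).add_const (1 / (l : ℂ))
      convert! h1.add ((hasDerivAt_id w).div_const ((l : ℂ) ^ 2)) using 1
      · ext
        simp
      · simp only [id_eq]
        ring
  have hz0 : z ≠ 0 := fun h ↦ hz (h ▸ zero_mem _)
  have h := ((hasDerivAt_inv hz0).add hsum).congr_of_eventuallyEq (f₁ := logDeriv L.sigma) ?_
  · convert! h using 1
    have := L.weierstrassPExcept_add 0 z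
    simp at this
    rw [← this]
    ring
  · filter_upwards [hopen.mem_nhds hz] with w hw
    have hw0 : w ≠ 0 := fun h ↦ hw (h ▸ zero_mem _)
    rw [Pi.add_apply, ← L.logDeriv_sigmaProd hw]
    have := logDeriv_mul w hw0 (L.sigmaProd_ne_zero hw) differentiableAt_id
      (L.differentiable_sigmaProd w)
    simpa [logDeriv_id] using! this

lemma exists_sigma_add_eq (l : L.lattice) :
    ∃ C η : ℂ, C ≠ 0 ∧ ∀ z, L.sigma (z + l) = C * exp (η * z) * L.sigma z := by
  have hopen := L.isClosed_lattice.isOpen_compl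
  have hadd {z : ℂ} (hz : z ∉ L.lattice) : z + l ∉ L.lattice := fun h ↦
    hz (by simpa using sub_mem h l.2)
  have hd {z : ℂ} (hz : z ∉ L.lattice) :
      HasDerivAt (fun z ↦ logDeriv L.sigma (z + l) - logDeriv L.sigma z) 0 z := by
    have := ((L.hasDerivAt_logDeriv_sigma (hadd hz)).comp_add_const z l).sub
      (L.hasDerivAt_logDeriv_sigma hz)
    simpa [L.weierstrassP_add_coe] using! this
  obtain ⟨η, hη⟩ := hopen.exists_is_const_of_deriv_eq_zero L.isPreconnected_compl_lattice
    (fun z hz ↦ (hd hz).differentiableAt.differentiableWithinAt) (fun z hz ↦ (hd hz).deriv)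
  have hshift : Differentiable ℂ fun z ↦ L.sigma (z + l) :=
    L.differentiable_sigma.comp (by fun_prop)
  have hmul : Differentiable ℂ fun z ↦ exp (η * z) * L.sigma z :=
    (by fun_prop : Differentiable ℂ fun z ↦ exp (η * z)).mul L.differentiable_sigma
  have hlog : Set.EqOn (logDeriv fun z ↦ L.sigma (z + l))
      (logDeriv fun z ↦ exp (η * z) * L.sigma z) (L.lattice : Set ℂ)ᶜ := by
    intro z hz
    have hexp : HasDerivAt (fun z ↦ exp (η * z)) (exp (η * z) * (η * 1)) z :=
      ((hasDerivAt_id z).const_mul η).cexp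
    rw [logDeriv_mul (f := fun z ↦ exp (η * z)) z (exp_ne_zero _) (L.sigma_ne_zero hz) hexp.differentiableAt
      (L.differentiable_sigma z), logDeriv_apply (fun z ↦ exp (η * z)), hexp.deriv,
      mul_one, mul_div_cancel_left₀ _ (exp_ne_zero _), ← hη z hz, sub_add_cancel,
      logDeriv_apply, logDeriv_apply, deriv_comp_add_const]
  obtain ⟨C, hC, h⟩ := (logDeriv_eqOn_iff hshift.differentiableOn hmul.differentiableOn hopen
    L.isPreconnected_compl_lattice (fun z hz ↦ mul_ne_zero (exp_ne_zero _) (L.sigma_ne_zero hz))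
    (fun z hz ↦ L.sigma_ne_zero (hadd hz))).mp hlog
  refine ⟨C, η, hC, fun z ↦ ?_⟩
  have := congrFun (hshift.continuous.ext_on L.dense_compl_lattice
    (hmul.continuous.const_smul C) h) z
  simpa [mul_assoc] using this

lemma sigma_eq_zero_iff {z : ℂ} : L.sigma z = 0 ↔ z ∈ L.lattice := by
  refine ⟨fun h ↦ by_contra fun hz ↦ L.sigma_ne_zero hz h, fun h ↦ ?_⟩
  obtain ⟨C, η, -, hadd⟩ := L.exists_sigma_add_eq ⟨z, h⟩
  simpa [sigma_zero] using hadd 0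

lemma deriv_sigma_ne_zero {z : ℂ} (hz : z ∈ L.lattice) : deriv L.sigma z ≠ 0 := by
  obtain ⟨C, η, hC, hadd⟩ := L.exists_sigma_add_eq ⟨z, hz⟩
  have h1 : HasDerivAt (fun w ↦ C * exp (η * w)) (C * (exp (η * 0) * (η * 1))) 0 :=
    ((hasDerivAt_id (0 : ℂ)).const_mul η).cexp.const_mul C
  have h2 := (h1.mul L.hasDerivAt_sigma_zero).deriv
  have h3 : (fun w ↦ C * exp (η * w)) * L.sigma = fun w ↦ L.sigma (w + z) :=
    funext fun w ↦ (hadd w).symm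
  rw [h3, deriv_comp_add_const, zero_add, sigma_zero] at h2
  simpa [h2] using hC

/-- Two entire functions with the same factors of automorphy for a lattice are proportional, if the
zeros of the second one are simple and are zeros of the first one. -/
lemma exists_eq_const_mul_of_zeros {f g : ℂ → ℂ} (hf : Differentiable ℂ f)
    (hg : Differentiable ℂ g) (hfg : ∀ z, g z = 0 → f z = 0) (hg' : ∀ z, g z = 0 → deriv g z ≠ 0)
    (hper : ∀ l ∈ L.lattice, ∃ m : ℂ → ℂ, (∀ z, m z ≠ 0) ∧ (∀ z, f (z + l) = m z * f z) ∧
      ∀ z, g (z + l) = m z * g z) :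
    ∃ k, ∀ z, f z = k * g z := by
  classical
  let H : ℂ → ℂ := fun z ↦ if g z = 0 then deriv f z / deriv g z else f z / g z
  have hne (z : ℂ) : ∀ᶠ w in 𝓝[≠] z, g w ≠ 0 := by
    by_cases hz : g z = 0
    · exact (hg z).hasDerivAt.eventually_ne (hg' z hz)
    · exact ((hg z).continuousAt.eventually_ne hz).filter_mono nhdsWithin_le_nhds
  have hH : Differentiable ℂ H := by
    intro z
    by_cases hz : g z = 0
    · have hslope {u : ℂ → ℂ} (hu : Differentiable ℂ u) : DifferentiableAt ℂ (dslope u z) z :=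
        ((differentiableOn_dslope univ_mem).mpr hu.differentiableOn).differentiableAt univ_mem
      refine ((hslope hf).div (hslope hg) (by simpa using hg' z hz)).congr_of_eventuallyEq ?_
      filter_upwards [eventually_nhdsWithin_iff.mp (hne z)] with w hw
      rcases eq_or_ne w z with rfl | hwz
      · simp [H, hz]
      · have := hw hwz
        have hwz' := sub_ne_zero.mpr hwz
        simp only [H, if_neg this, Pi.div_apply, dslope_of_ne _ hwz, slope_def_field, hz, hfg z hz,
          sub_zero]
        field
    · refine ((hf z).div (hg z) hz).congr_of_eventuallyEq ?_
      filter_upwards [(hg z).continuousAt.eventually_ne hz] with w hw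
      simp [H, hw]
  have hHper (z l : ℂ) (hl : l ∈ L.lattice) : H (z + l) = H z := by
    obtain ⟨m, hm, hfm, hgm⟩ := hper l hl
    have hcont : Continuous fun w ↦ H (w + l) := hH.continuous.comp (by fun_prop)
    refine Filter.EventuallyEq.eq_of_nhds (f := fun w ↦ H (w + l)) <|
      (hcont.continuousAt.eventuallyEq_nhds_iff_eventuallyEq_nhdsNE
        hH.continuous.continuousAt).mp ?_
    filter_upwards [hne z] with w hw
    simp only [H, hgm, hfm, hw, mul_eq_zero, hm w, or_self, if_false]
    exact mul_div_mul_left _ _ (hm w)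
  refine ⟨H 0, fun z ↦ ?_⟩
  have hconst : H z = H 0 := hH.apply_eq_apply_of_bounded
    (IsZLattice.isCompact_range_of_periodic L.lattice _ hH.continuous hHper).isBounded z 0
  by_cases hz : g z = 0
  · simp [hz, hfg z hz]
  · rw [← hconst]
    simp only [H, if_neg hz]
    rw [div_mul_cancel₀ _ hz]

/-- The left-hand side of the three-term identity. -/
noncomputable def threeTerm (z a b c : ℂ) : ℂ :=
  L.sigma (z + a) * L.sigma (z - a) * L.sigma (b + c) * L.sigma (b - c) +
    L.sigma (z + b) * L.sigma (z - b) * L.sigma (c + a) * L.sigma (c - a) +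
    L.sigma (z + c) * L.sigma (z - c) * L.sigma (a + b) * L.sigma (a - b)

lemma sigma_sub_comm (x y : ℂ) : L.sigma (x - y) = -L.sigma (y - x) := by
  rw [← sigma_neg, neg_sub]

lemma threeTerm_neg (z a b c : ℂ) : L.threeTerm (-z) a b c = L.threeTerm z a b c := by
  have h (x : ℂ) : L.sigma (-z + x) * L.sigma (-z - x) = L.sigma (z + x) * L.sigma (z - x) := by
    rw [← neg_sub z x |>.trans (neg_add_eq_sub z x |>.symm), ← neg_add', sigma_neg, sigma_neg]
    ring
  simp only [threeTerm, h]

lemma threeTerm_first_eq_second (a b c : ℂ) : L.threeTerm a a b c = 0 := by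
  rw [threeTerm, sub_self, sigma_zero, L.sigma_sub_comm c a, add_comm c a]
  ring

lemma threeTerm_first_eq_fourth (a b c : ℂ) : L.threeTerm c a b c = 0 := by
  rw [threeTerm, sub_self, sigma_zero, L.sigma_sub_comm c b, add_comm c b]
  ring

lemma threeTerm_eq_zero_of_notMem {a c : ℂ} (hc : 2 * c ∉ L.lattice) (hac : a + c ∉ L.lattice)
    (hac' : a - c ∉ L.lattice) (z b : ℂ) : L.threeTerm z a b c = 0 := by
  have hσ (x : ℂ) : Differentiable ℂ fun z ↦ L.sigma (z + x) :=
    L.differentiable_sigma.comp (by fun_prop)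
  have hσ' (x : ℂ) : Differentiable ℂ fun z ↦ L.sigma (z - x) :=
    L.differentiable_sigma.comp (by fun_prop)
  have hper (l : ℂ) (hl : l ∈ L.lattice) : ∃ m : ℂ → ℂ, (∀ z, m z ≠ 0) ∧ ∀ z x,
      L.sigma (z + l + x) * L.sigma (z + l - x) =
        m z * (L.sigma (z + x) * L.sigma (z - x)) := by
    obtain ⟨C, η, hC, hadd⟩ := L.exists_sigma_add_eq ⟨l, hl⟩
    refine ⟨fun z ↦ C ^ 2 * exp (2 * η * z), fun z ↦ by simp [hC], fun z x ↦ ?_⟩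
    have h : exp (2 * η * z) = exp (η * (z + x)) * exp (η * (z - x)) := by
      rw [← exp_add]
      ring_nf
    beta_reduce
    rw [add_right_comm, add_sub_right_comm, hadd, hadd, h]
    ring
  have hfper (l : ℂ) (hl : l ∈ L.lattice) : ∃ m : ℂ → ℂ, (∀ z, m z ≠ 0) ∧
      (∀ z, L.threeTerm (z + l) a b c = m z * L.threeTerm z a b c) ∧
      ∀ z, L.sigma (z + l + c) * L.sigma (z + l - c) =
        m z * (L.sigma (z + c) * L.sigma (z - c)) := by
    obtain ⟨m, hm, h⟩ := hper l hl
    refine ⟨m, hm, fun z ↦ ?_, fun z ↦ h z c⟩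
    simp only [threeTerm, h]
    ring
  have hzero (z : ℂ) (h : L.sigma (z + c) * L.sigma (z - c) = 0) :
      z + c ∈ L.lattice ∧ z - c ∉ L.lattice ∨ z + c ∉ L.lattice ∧ z - c ∈ L.lattice := by
    rw [mul_eq_zero, sigma_eq_zero_iff, sigma_eq_zero_iff] at h
    have : ¬(z + c ∈ L.lattice ∧ z - c ∈ L.lattice) := fun ⟨h1, h2⟩ ↦
      hc (by convert! sub_mem h1 h2 using 1; ring)
    tauto
  have hfzero (z : ℂ) (hz : L.sigma (z + c) * L.sigma (z - c) = 0) :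
      L.threeTerm z a b c = 0 := by
    rcases hzero z hz with ⟨h, -⟩ | ⟨-, h⟩
    · obtain ⟨m, -, hm, -⟩ := hfper _ h
      have := hm (-c)
      rwa [threeTerm_neg, threeTerm_first_eq_fourth, mul_zero, neg_add_cancel_comm_assoc] at this
    · obtain ⟨m, -, hm, -⟩ := hfper _ h
      have := hm c
      rwa [threeTerm_first_eq_fourth, mul_zero, add_sub_cancel] at this
  have hsimple (z : ℂ) (hz : L.sigma (z + c) * L.sigma (z - c) = 0) :
      deriv (fun z ↦ L.sigma (z + c) * L.sigma (z - c)) z ≠ 0 := by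
    have hd := ((hσ c z).hasDerivAt.mul (hσ' c z).hasDerivAt).deriv
    rw [deriv_comp_add_const, deriv_comp_sub_const] at hd
    refine ne_of_eq_of_ne hd ?_
    rcases hzero z hz with ⟨h, h'⟩ | ⟨h', h⟩
    · simpa [L.sigma_eq_zero_iff.mpr h] using ⟨L.deriv_sigma_ne_zero h, L.sigma_ne_zero h'⟩
    · simpa [L.sigma_eq_zero_iff.mpr h] using ⟨L.sigma_ne_zero h', L.deriv_sigma_ne_zero h⟩
  obtain ⟨k, hk⟩ := L.exists_eq_const_mul_of_zeros (f := fun z ↦ L.threeTerm z a b c)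
    (g := fun z ↦ L.sigma (z + c) * L.sigma (z - c)) (by unfold threeTerm; fun_prop)
    (by fun_prop) hfzero hsimple hfper
  have ha := hk a
  simp only [threeTerm_first_eq_second, zero_eq_mul, mul_eq_zero, sigma_eq_zero_iff, hac, hac',
    or_false] at ha
  simpa [ha] using hk z

theorem threeTerm_eq_zero (z a b c : ℂ) : L.threeTerm z a b c = 0 := by
  have hcount : ((fun c ↦ 2 * c) ⁻¹' (L.lattice : Set ℂ) ∪ (fun c ↦ a + c) ⁻¹' L.lattice ∪
      (fun c ↦ a - c) ⁻¹' L.lattice).Countable :=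
    ((L.countable_lattice.preimage (mul_right_injective₀ two_ne_zero)).union
      (L.countable_lattice.preimage (add_right_injective a))).union
      (L.countable_lattice.preimage sub_right_injective)
  have hσ := L.differentiable_sigma.continuous
  have hcont : Continuous fun c ↦ L.threeTerm z a b c := by
    unfold threeTerm
    fun_prop
  refine congrFun (hcont.ext_on (hcount.dense_compl ℂ) continuous_zero fun c hc ↦ ?_) c
  simp only [Set.mem_compl_iff, Set.mem_union, Set.mem_preimage, SetLike.mem_coe, not_or] at hc
  exact L.threeTerm_eq_zero_of_notMem hc.1.1 hc.1.2 hc.2 z b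

end PeriodPair

lemma linearIndependent_pair_of_im_div_pos {ω₁ ω₃ : ℂ} (h : 0 < (ω₃ / ω₁).im) :
    LinearIndependent ℝ ![2 * ω₁, 2 * ω₃] := by
  have hω₁ : ω₁ ≠ 0 := by
    rintro rfl
    simp at h
  refine LinearIndependent.pair_iff.mpr fun s t hst ↦ ?_
  have h1 : (s : ℂ) + t * (ω₃ / ω₁) = 0 := by
    rw [real_smul, real_smul] at hst
    field_simp
    linear_combination hst / 2
  have ht : t = 0 := by simpa [h.ne'] using congrArg im h1
  exact ⟨by simpa [ht] using h1, ht⟩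

lemma wSigma_eq_sigma (L : PeriodPair) {ω₁ ω₃ : ℂ} (h₁ : L.ω₁ = 2 * ω₁) (h₃ : L.ω₂ = 2 * ω₃)
    (z : ℂ) : wSigma ω₁ ω₃ z = L.sigma z := by
  have hpt (p : ℤ × ℤ) : (L.latticeEquivProd.symm p : ℂ) = latticePoint ω₁ ω₃ p := by
    rw [L.latticeEquiv_symm_apply, h₁, h₃, latticePoint]
    ring
  rw [wSigma, PeriodPair.sigma, PeriodPair.sigmaProd,
    ← L.latticeEquivProd.symm.toEquiv.tprod_eq (fun l ↦ sigmaFactor l z)]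
  congr 1
  refine (tprod_subtype_eq_of_mulSupport_subset (s := {p : ℤ × ℤ | p ≠ (0, 0)})
    (f := fun p ↦ sigmaFactor (latticePoint ω₁ ω₃ p) z) fun p hp h ↦ hp ?_).trans
    (tprod_congr fun p ↦ ?_)
  · simp [h, latticePoint]
  · rw [← hpt p]
    rfl

/-- the Weierstrass three-term identity. -/
theorem weierstrass_three_term
    (ω₁ ω₃ : ℂ) (hω₁ : ω₁ ≠ 0) (hω₃ : ω₃ ≠ 0) (hIm : 0 < (ω₃ / ω₁).im)
    (z a b c : ℂ) :
    wSigma ω₁ ω₃ (z + a) * wSigma ω₁ ω₃ (z - a) * wSigma ω₁ ω₃ (b + c) * wSigma ω₁ ω₃ (b - c) +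
      wSigma ω₁ ω₃ (z + b) * wSigma ω₁ ω₃ (z - b) * wSigma ω₁ ω₃ (c + a) * wSigma ω₁ ω₃ (c - a) +
      wSigma ω₁ ω₃ (z + c) * wSigma ω₁ ω₃ (z - c) * wSigma ω₁ ω₃ (a + b) * wSigma ω₁ ω₃ (a - b)
      = 0 := by
  let L : PeriodPair := ⟨2 * ω₁, 2 * ω₃, linearIndependent_pair_of_im_div_pos hIm⟩
  simp only [wSigma_eq_sigma L rfl rfl]
  exact L.threeTerm_eq_zero z a b c
end

section
/- For every a, b ∈ ℂ, one has θ₁(a+b,τ) θ₂(a−b,τ) θ₃(0,τ) θ₄(0,τ) = θ₁(a,τ) θ₂(a,τ) θ₃(b,τ) θ₄(b,τ) + θ₁(b,τ) θ₂(b,τ) θ₃(a,τ) θ₄(a,τ). -/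
open Complex

/-- The Jacobi theta function `θ₁(z,τ) = −i ∑ₙ (−1)ⁿ q^{(n+1/2)²} e^{(2n+1)iz}`, `q = e^{πiτ}`. -/
noncomputable def jTheta1 (z τ : ℂ) : ℂ :=
  -I * ∑' n : ℤ, (-1 : ℂ) ^ n *
    Complex.exp (Real.pi * I * τ * ((n : ℂ) + 1 / 2) ^ 2 + (2 * (n : ℂ) + 1) * I * z)

/-- The Jacobi theta function `θ₂(z,τ) = ∑ₙ q^{(n+1/2)²} e^{(2n+1)iz}`, `q = e^{πiτ}`. -/
noncomputable def jTheta2 (z τ : ℂ) : ℂ :=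
  ∑' n : ℤ,
    Complex.exp (Real.pi * I * τ * ((n : ℂ) + 1 / 2) ^ 2 + (2 * (n : ℂ) + 1) * I * z)

/-- The Jacobi theta function `θ₃(z,τ) = ∑ₙ q^{n²} e^{2niz}`, `q = e^{πiτ}`. -/
noncomputable def jTheta3 (z τ : ℂ) : ℂ :=
  ∑' n : ℤ, Complex.exp (Real.pi * I * τ * (n : ℂ) ^ 2 + 2 * (n : ℂ) * I * z)

/-- The Jacobi theta function `θ₄(z,τ) = ∑ₙ (−1)ⁿ q^{n²} e^{2niz}`, `q = e^{πiτ}`. -/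
noncomputable def jTheta4 (z τ : ℂ) : ℂ :=
  ∑' n : ℤ, (-1 : ℂ) ^ n *
    Complex.exp (Real.pi * I * τ * (n : ℂ) ^ 2 + 2 * (n : ℂ) * I * z)

/-- Splitting a double sum over `ℤ × ℤ` according to the parity of the sum of the indices. -/
theorem tsum_int_prod_eq_add_of_parity {f : ℤ × ℤ → ℂ} (hf : Summable f) :
    ∑' p, f p = ∑' p : ℤ × ℤ, f (p.1 + p.2, p.1 - p.2) +
      ∑' p : ℤ × ℤ, f (p.1 + p.2, p.1 - p.2 - 1) := by
  let g : (ℤ × ℤ) ⊕ (ℤ × ℤ) → ℤ × ℤ :=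
    Sum.elim (fun p => (p.1 + p.2, p.1 - p.2)) (fun p => (p.1 + p.2, p.1 - p.2 - 1))
  have hg : Function.Bijective g := by
    constructor
    · rintro (⟨a, b⟩ | ⟨a, b⟩) (⟨c, d⟩ | ⟨c, d⟩) h <;>
        simp only [g, Sum.elim_inl, Sum.elim_inr, Prod.mk.injEq, Sum.inl.injEq, Sum.inr.injEq,
          reduceCtorEq] at h ⊢ <;> omega
    · rintro ⟨m, n⟩
      rcases Int.even_or_odd' (m + n) with ⟨k, hk | hk⟩
      · refine ⟨Sum.inl (k, m - k), ?_⟩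
        simp only [g, Sum.elim_inl, Prod.mk.injEq]
        omega
      · refine ⟨Sum.inr (k + 1, m - k - 1), ?_⟩
        simp only [g, Sum.elim_inr, Prod.mk.injEq]
        omega
  have hs : Summable (f ∘ g) := hf.comp_injective hg.injective
  rw [← (Equiv.ofBijective g hg).tsum_eq f]
  exact Summable.tsum_sum (f := f ∘ g) (hs.comp_injective Sum.inl_injective)
    (hs.comp_injective Sum.inr_injective)

/-- The variant of `tsum_int_prod_eq_add_of_parity` with the odd part shifted by one. -/
theorem tsum_int_prod_eq_add_of_parity' {f : ℤ × ℤ → ℂ} (hf : Summable f) :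
    ∑' p, f p = ∑' p : ℤ × ℤ, f (p.1 + p.2, p.1 - p.2) +
      ∑' p : ℤ × ℤ, f (p.1 + p.2 + 1, p.1 - p.2) := by
  rw [tsum_int_prod_eq_add_of_parity hf,
    ← ((Equiv.addRight (1 : ℤ)).prodCongr (Equiv.refl ℤ)).tsum_eq
      (fun p : ℤ × ℤ => f (p.1 + p.2, p.1 - p.2 - 1))]
  congr 1
  refine tsum_congr fun p => congrArg f ?_
  simp only [Equiv.prodCongr_apply, Prod.map, Equiv.coe_addRight, Equiv.refl_apply, Prod.mk.injEq]
  omega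

theorem summable_norm_jTheta3_term (z : ℂ) {τ : ℂ} (hτ : 0 < τ.im) :
    Summable fun n : ℤ =>
      ‖Complex.exp (Real.pi * I * τ * (n : ℂ) ^ 2 + 2 * (n : ℂ) * I * z)‖ := by
  refine ((summable_jacobiTheta₂_term_iff (z / Real.pi) τ).2 hτ).norm.congr fun n => ?_
  have hpi : (Real.pi : ℂ) ≠ 0 := by exact_mod_cast Real.pi_ne_zero
  rw [jacobiTheta₂_term]
  congr 2
  field_simp
  ring

theorem summable_norm_jTheta2_term (z : ℂ) {τ : ℂ} (hτ : 0 < τ.im) :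
    Summable fun n : ℤ => ‖Complex.exp
      (Real.pi * I * τ * ((n : ℂ) + 1 / 2) ^ 2 + (2 * (n : ℂ) + 1) * I * z)‖ := by
  refine ((summable_norm_jTheta3_term (z + Real.pi * τ / 2) hτ).mul_left
    ‖Complex.exp (Real.pi * I * τ / 4 + I * z)‖).congr fun n => ?_
  rw [← norm_mul, ← Complex.exp_add]
  congr 2
  ring

theorem summable_norm_jTheta4_term (z : ℂ) {τ : ℂ} (hτ : 0 < τ.im) :
    Summable fun n : ℤ => ‖(-1 : ℂ) ^ n *
      Complex.exp (Real.pi * I * τ * (n : ℂ) ^ 2 + 2 * (n : ℂ) * I * z)‖ := by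
  simpa using summable_norm_jTheta3_term z hτ

theorem summable_norm_jTheta1_term (z : ℂ) {τ : ℂ} (hτ : 0 < τ.im) :
    Summable fun n : ℤ => ‖(-1 : ℂ) ^ n * Complex.exp
      (Real.pi * I * τ * ((n : ℂ) + 1 / 2) ^ 2 + (2 * (n : ℂ) + 1) * I * z)‖ := by
  simpa using summable_norm_jTheta2_term z hτ

theorem jTheta1_zero (τ : ℂ) : jTheta1 0 τ = 0 := by
  rw [jTheta1, mul_eq_zero]
  right
  rw [← self_eq_neg, ← tsum_neg, ← (Equiv.subLeft (-1 : ℤ)).tsum_eq]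
  refine tsum_congr fun n => ?_
  have hsign : (-1 : ℂ) ^ (-1 - n) = -(-1) ^ n := by
    rw [zpow_sub₀ (by norm_num), zpow_neg_one, div_eq_mul_inv, ← inv_zpow]
    norm_num
  rw [Equiv.subLeft_apply, hsign, neg_mul]
  congr 3
  push_cast
  ring

theorem neg_one_zpow_sub (r s : ℤ) : (-1 : ℂ) ^ (r - s) = (-1) ^ r * (-1) ^ s := by
  rw [zpow_sub₀ (by norm_num), div_eq_mul_inv, ← inv_zpow]
  norm_num

theorem jTheta1_mul_jTheta2 (x y : ℂ) {τ : ℂ} (hτ : 0 < τ.im) :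
    jTheta1 x τ * jTheta2 y τ =
      jTheta1 (x + y) (2 * τ) * jTheta4 (x - y) (2 * τ) +
        jTheta4 (x + y) (2 * τ) * jTheta1 (x - y) (2 * τ) := by
  have hτ' : 0 < (2 * τ).im := by simpa using hτ
  have h1 := summable_norm_jTheta1_term x hτ
  have h2 := summable_norm_jTheta2_term y hτ
  have hs := summable_mul_of_summable_norm h1 h2
  simp only [jTheta1, jTheta2, jTheta4]
  rw [mul_assoc (-I), mul_assoc (-I), mul_left_comm _ (-I),
    tsum_mul_tsum_of_summable_norm h1 h2, tsum_int_prod_eq_add_of_parity hs,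
    tsum_mul_tsum_of_summable_norm (summable_norm_jTheta1_term (x + y) hτ')
      (summable_norm_jTheta4_term (x - y) hτ'),
    tsum_mul_tsum_of_summable_norm (summable_norm_jTheta4_term (x + y) hτ')
      (summable_norm_jTheta1_term (x - y) hτ'), mul_add]
  congr 2 <;>
  · refine tsum_congr fun p => ?_
    rw [zpow_add₀ (by norm_num), mul_mul_mul_comm, mul_assoc, ← Complex.exp_add,
      ← Complex.exp_add]
    congr 2
    push_cast
    ring

theorem jTheta3_mul_jTheta4 (x y : ℂ) {τ : ℂ} (hτ : 0 < τ.im) :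
    jTheta3 x τ * jTheta4 y τ =
      jTheta4 (x + y) (2 * τ) * jTheta4 (x - y) (2 * τ) -
        jTheta1 (x + y) (2 * τ) * jTheta1 (x - y) (2 * τ) := by
  have hτ' : 0 < (2 * τ).im := by simpa using hτ
  have h3 := summable_norm_jTheta3_term x hτ
  have h4 := summable_norm_jTheta4_term y hτ
  have hs := summable_mul_of_summable_norm h3 h4
  simp only [jTheta1, jTheta3, jTheta4]
  rw [mul_mul_mul_comm (-I), neg_mul_neg, I_mul_I, neg_one_mul, sub_neg_eq_add,
    tsum_mul_tsum_of_summable_norm h3 h4, tsum_int_prod_eq_add_of_parity' hs,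
    tsum_mul_tsum_of_summable_norm (summable_norm_jTheta4_term (x + y) hτ')
      (summable_norm_jTheta4_term (x - y) hτ'),
    tsum_mul_tsum_of_summable_norm (summable_norm_jTheta1_term (x + y) hτ')
      (summable_norm_jTheta1_term (x - y) hτ')]
  congr 1 <;>
  · refine tsum_congr fun p => ?_
    rw [neg_one_zpow_sub, mul_mul_mul_comm, mul_left_comm, ← Complex.exp_add, ← Complex.exp_add]
    congr 2
    push_cast
    ring

/-- `θ₁(a+b)θ₂(a−b)θ₃θ₄ = θ₁(a)θ₂(a)θ₃(b)θ₄(b) + θ₁(b)θ₂(b)θ₃(a)θ₄(a)`. -/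
theorem jacobi_theta12_addition (τ : ℂ) (hτ : 0 < τ.im) (a b : ℂ) :
    jTheta1 (a + b) τ * jTheta2 (a - b) τ * jTheta3 0 τ * jTheta4 0 τ =
      jTheta1 a τ * jTheta2 a τ * jTheta3 b τ * jTheta4 b τ +
        jTheta1 b τ * jTheta2 b τ * jTheta3 a τ * jTheta4 a τ := by
  have h12 (x : ℂ) := jTheta1_mul_jTheta2 x x hτ
  have h34 (x : ℂ) := jTheta3_mul_jTheta4 x x hτ
  simp only [sub_self, jTheta1_zero, mul_zero, add_zero, sub_zero] at h12 h34
  have h := jTheta1_mul_jTheta2 (a + b) (a - b) hτ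
  rw [show a + b + (a - b) = a + a by ring, show a + b - (a - b) = b + b by ring] at h
  rw [mul_assoc, h, h34, mul_assoc (jTheta1 a τ * _), mul_assoc (jTheta1 b τ * _),
    h12, h12, h34, h34, add_zero]
  ring
end

section
/- For every a, b, c, d ∈ ℂ, define a* = (−a+b+c+d)/2, b* = (a−b+c+d)/2, c* = (a+b−c+d)/2, d* = (a+b+c−d)/2. With the notation [j] = θ_j(a,τ)θ_j(b,τ)θ_j(c,τ)θ_j(d,τ) and [j]* = θ_j(a*,τ)θ_j(b*,τ)θ_j(c*,τ)θ_j(d*,τ), one has 2[3] = −[1]* + [2]* + [3]* + [4]* (Jacobi's fundamental identity). -/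
open Complex

/-- The `n`-th term of the series of `θ₃` for `δ = 0`, and of that of `θ₂` for `δ = 1 / 2`. -/
noncomputable def thetaTerm (δ z τ : ℂ) (n : ℤ) : ℂ :=
  cexp (Real.pi * I * τ * ((n : ℂ) + δ) ^ 2 + (2 * (n : ℂ) + 2 * δ) * I * z)

lemma thetaTerm_eq_mul_jacobiTheta₂_term (δ z τ : ℂ) (n : ℤ) :
    thetaTerm δ z τ n = cexp (Real.pi * I * τ * δ ^ 2 + 2 * δ * I * z) *
      jacobiTheta₂_term n (z / Real.pi + δ * τ) τ := by
  have hpi : (Real.pi : ℂ) ≠ 0 := Complex.ofReal_ne_zero.mpr Real.pi_ne_zero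
  rw [thetaTerm, jacobiTheta₂_term, ← Complex.exp_add]
  congr 1
  field_simp
  ring

lemma summable_thetaTerm (δ z : ℂ) {τ : ℂ} (hτ : 0 < τ.im) : Summable (thetaTerm δ z τ) := by
  simp_rw [funext (thetaTerm_eq_mul_jacobiTheta₂_term δ z τ)]
  exact ((summable_jacobiTheta₂_term_iff _ _).mpr hτ).mul_left _

lemma summable_neg_one_zpow_mul_thetaTerm (δ z : ℂ) {τ : ℂ} (hτ : 0 < τ.im) :
    Summable fun n : ℤ ↦ (-1 : ℂ) ^ n * thetaTerm δ z τ n := by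
  refine Summable.of_norm ?_
  simpa using (summable_thetaTerm δ z hτ).norm

lemma jTheta1_eq_tsum (z τ : ℂ) :
    jTheta1 z τ = -I * ∑' n : ℤ, (-1 : ℂ) ^ n * thetaTerm (1 / 2) z τ n := by
  simp [jTheta1, thetaTerm]

lemma jTheta2_eq_tsum (z τ : ℂ) : jTheta2 z τ = ∑' n : ℤ, thetaTerm (1 / 2) z τ n := by
  simp [jTheta2, thetaTerm]

lemma jTheta3_eq_tsum (z τ : ℂ) : jTheta3 z τ = ∑' n : ℤ, thetaTerm 0 z τ n := by
  simp [jTheta3, thetaTerm]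

lemma jTheta4_eq_tsum (z τ : ℂ) :
    jTheta4 z τ = ∑' n : ℤ, (-1 : ℂ) ^ n * thetaTerm 0 z τ n := by
  simp [jTheta4, thetaTerm]

lemma HasSum.mul_complex {ι κ : Type*} {f : ι → ℂ} {g : κ → ℂ} {a b : ℂ} (hf : HasSum f a)
    (hg : HasSum g b) : HasSum (fun p : ι × κ ↦ f p.1 * g p.2) (a * b) :=
  hf.mul hg (summable_mul_of_summable_norm hf.summable.norm hg.summable.norm)

/-- A product of four convergent complex series is the sum of the products of their terms. -/
lemma hasSum_mul_mul_mul {ι : Type*} {f g h k : ι → ℂ} (hf : Summable f) (hg : Summable g)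
    (hh : Summable h) (hk : Summable k) :
    HasSum (fun p : (ι × ι) × (ι × ι) ↦ f p.1.1 * g p.1.2 * h p.2.1 * k p.2.2)
      ((∑' n, f n) * (∑' n, g n) * (∑' n, h n) * ∑' n, k n) := by
  simpa only [mul_assoc] using
    (hf.hasSum.mul_complex hg.hasSum).mul_complex (hh.hasSum.mul_complex hk.hasSum)

/-- The bijection of `ℤ⁴` sending `n` to `⌊S / 2⌋ - n`, where `S` is the sum of the coordinates. -/
def halfSumSub : (ℤ × ℤ) × (ℤ × ℤ) ≃ (ℤ × ℤ) × (ℤ × ℤ) where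
  toFun p :=
    let s := (p.1.1 + p.1.2 + p.2.1 + p.2.2) / 2
    ((s - p.1.1, s - p.1.2), (s - p.2.1, s - p.2.2))
  invFun p :=
    let s := (p.1.1 + p.1.2 + p.2.1 + p.2.2 + 1) / 2
    ((s - p.1.1, s - p.1.2), (s - p.2.1, s - p.2.2))
  left_inv := by
    rintro ⟨⟨a, b⟩, ⟨c, d⟩⟩
    simp only [Prod.mk.injEq]
    omega
  right_inv := by
    rintro ⟨⟨a, b⟩, ⟨c, d⟩⟩
    simp only [Prod.mk.injEq]
    omega

/-- The product of the terms of the four theta series at `a*`, `b*`, `c*`, `d*`. -/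
noncomputable def dualTerm (δ τ a b c d : ℂ) (p : (ℤ × ℤ) × (ℤ × ℤ)) : ℂ :=
  thetaTerm δ ((-a + b + c + d) / 2) τ p.1.1 * thetaTerm δ ((a - b + c + d) / 2) τ p.1.2 *
    thetaTerm δ ((a + b - c + d) / 2) τ p.2.1 * thetaTerm δ ((a + b + c - d) / 2) τ p.2.2

/-- The sign `(-1) ^ S`, where `S` is the sum of the coordinates. -/
noncomputable def sumSign (p : (ℤ × ℤ) × (ℤ × ℤ)) : ℂ :=
  (-1) ^ p.1.1 * (-1) ^ p.1.2 * (-1) ^ p.2.1 * (-1) ^ p.2.2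

lemma sumSign_eq_zpow (p : (ℤ × ℤ) × (ℤ × ℤ)) :
    sumSign p = (-1) ^ (p.1.1 + p.1.2 + p.2.1 + p.2.2) := by
  have h : (-1 : ℂ) ≠ 0 := by norm_num
  simp only [sumSign, zpow_add₀ h]

lemma dualTerm_halfSumSub (τ a b c d : ℂ) (p : (ℤ × ℤ) × (ℤ × ℤ)) :
    (1 - sumSign (halfSumSub p)) * dualTerm (1 / 2) τ a b c d (halfSumSub p) +
        (1 + sumSign (halfSumSub p)) * dualTerm 0 τ a b c d (halfSumSub p) =
      2 * (thetaTerm 0 a τ p.1.1 * thetaTerm 0 b τ p.1.2 * thetaTerm 0 c τ p.2.1 *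
        thetaTerm 0 d τ p.2.2) := by
  obtain ⟨⟨k, l⟩, ⟨m, n⟩⟩ := p
  rw [sumSign_eq_zpow]
  obtain ⟨s, hs | hs⟩ := Int.even_or_odd' (k + l + m + n)
  · have hhalf : (k + l + m + n) / 2 = s := by omega
    obtain rfl : n = 2 * s - k - l - m := by omega
    have hsign : (-1 : ℂ) ^ (s - k + (s - l) + (s - m) + (s - (2 * s - k - l - m))) = 1 :=
      Even.neg_one_zpow ⟨s, by ring⟩
    simp only [halfSumSub, Equiv.coe_fn_mk, hhalf, hsign, sub_self, zero_mul, zero_add, dualTerm,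
      thetaTerm, ← Complex.exp_add, one_add_one_eq_two]
    congr 2
    push_cast
    ring
  · have hhalf : (k + l + m + n) / 2 = s := by omega
    obtain rfl : n = 2 * s + 1 - k - l - m := by omega
    have hsign : (-1 : ℂ) ^ (s - k + (s - l) + (s - m) + (s - (2 * s + 1 - k - l - m))) = -1 :=
      Odd.neg_one_zpow ⟨s - 1, by ring⟩
    simp only [halfSumSub, Equiv.coe_fn_mk, hhalf, hsign, add_neg_cancel, zero_mul, add_zero,
      dualTerm, thetaTerm, ← Complex.exp_add, sub_neg_eq_add, one_add_one_eq_two]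
    congr 2
    push_cast
    ring

/-- Jacobi's fundamental identity `2[3] = −[1]* + [2]* + [3]* + [4]*`. -/
theorem jacobi_fundamental_identity (τ : ℂ) (hτ : 0 < τ.im) (a b c d : ℂ) :
    2 * (jTheta3 a τ * jTheta3 b τ * jTheta3 c τ * jTheta3 d τ) =
      -(jTheta1 ((-a + b + c + d) / 2) τ * jTheta1 ((a - b + c + d) / 2) τ *
          jTheta1 ((a + b - c + d) / 2) τ * jTheta1 ((a + b + c - d) / 2) τ) +
        jTheta2 ((-a + b + c + d) / 2) τ * jTheta2 ((a - b + c + d) / 2) τ *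
          jTheta2 ((a + b - c + d) / 2) τ * jTheta2 ((a + b + c - d) / 2) τ +
        jTheta3 ((-a + b + c + d) / 2) τ * jTheta3 ((a - b + c + d) / 2) τ *
          jTheta3 ((a + b - c + d) / 2) τ * jTheta3 ((a + b + c - d) / 2) τ +
        jTheta4 ((-a + b + c + d) / 2) τ * jTheta4 ((a - b + c + d) / 2) τ *
          jTheta4 ((a + b - c + d) / 2) τ * jTheta4 ((a + b + c - d) / 2) τ := by
  have sgn (δ z : ℂ) := summable_neg_one_zpow_mul_thetaTerm δ z hτ
  have h₁ := hasSum_mul_mul_mul (sgn (1 / 2) ((-a + b + c + d) / 2))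
    (sgn (1 / 2) ((a - b + c + d) / 2)) (sgn (1 / 2) ((a + b - c + d) / 2))
    (sgn (1 / 2) ((a + b + c - d) / 2))
  have pos (δ z : ℂ) := summable_thetaTerm δ z hτ
  have h₂ := hasSum_mul_mul_mul (pos (1 / 2) ((-a + b + c + d) / 2))
    (pos (1 / 2) ((a - b + c + d) / 2)) (pos (1 / 2) ((a + b - c + d) / 2))
    (pos (1 / 2) ((a + b + c - d) / 2))
  have h₃ := hasSum_mul_mul_mul (pos 0 ((-a + b + c + d) / 2)) (pos 0 ((a - b + c + d) / 2))
    (pos 0 ((a + b - c + d) / 2)) (pos 0 ((a + b + c - d) / 2))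
  have h₄ := hasSum_mul_mul_mul (sgn 0 ((-a + b + c + d) / 2)) (sgn 0 ((a - b + c + d) / 2))
    (sgn 0 ((a + b - c + d) / 2)) (sgn 0 ((a + b + c - d) / 2))
  have h := (hasSum_mul_mul_mul (pos 0 a) (pos 0 b) (pos 0 c) (pos 0 d)).mul_left 2
  have hdual := halfSumSub.hasSum_iff.mpr (((h₁.neg.add h₂).add h₃).add h₄)
  have heq := h.unique <| hdual.congr_fun fun p ↦ by
    rw [← dualTerm_halfSumSub]
    simp only [Function.comp_apply, dualTerm, sumSign]
    ring
  simp only [jTheta1_eq_tsum, jTheta2_eq_tsum, jTheta3_eq_tsum, jTheta4_eq_tsum]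
  rw [heq, neg_mul, neg_mul, neg_mul, neg_mul]
  ring_nf
  simp only [I_pow_four, mul_one]
end

section
/- Fix b, c, d ∈ ℂ and define, as functions of a, the quantities a* = (−a+b+c+d)/2, b* = (a−b+c+d)/2, c* = (a+b−c+d)/2, d* = (a+b+c−d)/2, and ψ₃(a) = 2 θ₃(a,τ)θ₃(b,τ)θ₃(c,τ)θ₃(d,τ) + θ₁(a*,τ)θ₁(b*,τ)θ₁(c*,τ)θ₁(d*,τ) − θ₂(a*,τ)θ₂(b*,τ)θ₂(c*,τ)θ₂(d*,τ) − θ₃(a*,τ)θ₃(b*,τ)θ₃(c*,τ)θ₃(d*,τ) − θ₄(a*,τ)θ₄(b*,τ)θ₄(c*,τ)θ₄(d*,τ). Then for all a ∈ ℂ, ψ₃(a + π) = ψ₃(a) and ψ₃(a + πτ) = q^{−1} e^{−2ia} ψ₃(a), where q = e^{πiτ}. -/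
open Complex

/-- The factor `q^{-1/4} e^{-iz}` by which theta functions change under a shift by `πτ/2`. -/
noncomputable def halfPeriodFactor (z τ : ℂ) : ℂ :=
  Complex.exp (-(Real.pi * I * τ) / 4 - I * z)

theorem exp_int_mul_pi_mul_I (n : ℤ) : Complex.exp (n * (Real.pi * I)) = (-1 : ℂ) ^ n := by
  rw [Complex.exp_int_mul, Complex.exp_pi_mul_I]

theorem neg_one_zpow_mul_self (n : ℤ) : (-1 : ℂ) ^ n * (-1 : ℂ) ^ n = 1 := by
  rw [← mul_zpow]; simp

theorem jTheta1_add_half_pi (z τ : ℂ) : jTheta1 (z + Real.pi / 2) τ = jTheta2 z τ := by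
  unfold jTheta1 jTheta2
  rw [← tsum_mul_left]
  refine tsum_congr fun n => ?_
  rw [show (Real.pi * I * τ * ((n : ℂ) + 1 / 2) ^ 2 + (2 * (n : ℂ) + 1) * I * (z + Real.pi / 2)) =
    (Real.pi * I * τ * ((n : ℂ) + 1 / 2) ^ 2 + (2 * (n : ℂ) + 1) * I * z) + n * (Real.pi * I) +
      Real.pi / 2 * I by ring, Complex.exp_add, Complex.exp_add, exp_int_mul_pi_mul_I,
    Complex.exp_pi_div_two_mul_I]
  linear_combination (-I * I * Complex.exp (Real.pi * I * τ * ((n : ℂ) + 1 / 2) ^ 2 +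
    (2 * (n : ℂ) + 1) * I * z)) * neg_one_zpow_mul_self n - Complex.exp (Real.pi * I * τ *
    ((n : ℂ) + 1 / 2) ^ 2 + (2 * (n : ℂ) + 1) * I * z) * I_mul_I

theorem jTheta2_add_half_pi (z τ : ℂ) : jTheta2 (z + Real.pi / 2) τ = -jTheta1 z τ := by
  unfold jTheta1 jTheta2
  rw [neg_mul, neg_neg, ← tsum_mul_left]
  refine tsum_congr fun n => ?_
  rw [show (Real.pi * I * τ * ((n : ℂ) + 1 / 2) ^ 2 + (2 * (n : ℂ) + 1) * I * (z + Real.pi / 2)) =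
    (Real.pi * I * τ * ((n : ℂ) + 1 / 2) ^ 2 + (2 * (n : ℂ) + 1) * I * z) + n * (Real.pi * I) +
      Real.pi / 2 * I by ring, Complex.exp_add, Complex.exp_add, exp_int_mul_pi_mul_I,
    Complex.exp_pi_div_two_mul_I]
  ring

theorem jTheta3_add_half_pi (z τ : ℂ) : jTheta3 (z + Real.pi / 2) τ = jTheta4 z τ := by
  unfold jTheta3 jTheta4
  refine tsum_congr fun n => ?_
  rw [← exp_int_mul_pi_mul_I, ← Complex.exp_add]
  ring_nf

theorem jTheta4_add_half_pi (z τ : ℂ) : jTheta4 (z + Real.pi / 2) τ = jTheta3 z τ := by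
  unfold jTheta3 jTheta4
  refine tsum_congr fun n => ?_
  rw [show (Real.pi * I * τ * (n : ℂ) ^ 2 + 2 * (n : ℂ) * I * (z + Real.pi / 2)) =
    n * (Real.pi * I) + (Real.pi * I * τ * (n : ℂ) ^ 2 + 2 * (n : ℂ) * I * z) by ring,
    Complex.exp_add, exp_int_mul_pi_mul_I, ← mul_assoc, neg_one_zpow_mul_self, one_mul]

theorem jTheta1_sub_half_pi (z τ : ℂ) : jTheta1 (z - Real.pi / 2) τ = -jTheta2 z τ := by
  have h := jTheta2_add_half_pi (z - Real.pi / 2) τ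
  rw [sub_add_cancel] at h
  rw [h, neg_neg]

theorem jTheta2_sub_half_pi (z τ : ℂ) : jTheta2 (z - Real.pi / 2) τ = jTheta1 z τ := by
  rw [← jTheta1_add_half_pi, sub_add_cancel]

theorem jTheta3_sub_half_pi (z τ : ℂ) : jTheta3 (z - Real.pi / 2) τ = jTheta4 z τ := by
  rw [← jTheta4_add_half_pi, sub_add_cancel]

theorem jTheta4_sub_half_pi (z τ : ℂ) : jTheta4 (z - Real.pi / 2) τ = jTheta3 z τ := by
  rw [← jTheta3_add_half_pi, sub_add_cancel]

theorem jTheta3_add_half_pi_mul (z τ : ℂ) :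
    jTheta3 (z + Real.pi * τ / 2) τ = halfPeriodFactor z τ * jTheta2 z τ := by
  unfold jTheta3 jTheta2 halfPeriodFactor
  rw [← tsum_mul_left]
  refine tsum_congr fun n => ?_
  rw [← Complex.exp_add]
  ring_nf

theorem jTheta4_add_half_pi_mul (z τ : ℂ) :
    jTheta4 (z + Real.pi * τ / 2) τ = I * halfPeriodFactor z τ * jTheta1 z τ := by
  have h : jTheta4 (z + Real.pi * τ / 2) τ = halfPeriodFactor z τ * ∑' n : ℤ, (-1 : ℂ) ^ n *
      Complex.exp (Real.pi * I * τ * ((n : ℂ) + 1 / 2) ^ 2 + (2 * (n : ℂ) + 1) * I * z) := by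
    unfold jTheta4 halfPeriodFactor
    rw [← tsum_mul_left]
    refine tsum_congr fun n => ?_
    rw [mul_left_comm, ← Complex.exp_add]
    ring_nf
  rw [h, jTheta1]
  linear_combination (-halfPeriodFactor z τ * ∑' n : ℤ, (-1 : ℂ) ^ n *
      Complex.exp (Real.pi * I * τ * ((n : ℂ) + 1 / 2) ^ 2 + (2 * (n : ℂ) + 1) * I * z)) *
    -I_mul_I

theorem jTheta2_add_half_pi_mul (z τ : ℂ) :
    jTheta2 (z + Real.pi * τ / 2) τ = halfPeriodFactor z τ * jTheta3 z τ := by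
  unfold jTheta3 jTheta2 halfPeriodFactor
  rw [← tsum_mul_left, ← (Equiv.addRight (1 : ℤ)).tsum_eq (fun n : ℤ => Complex.exp _ * _)]
  refine tsum_congr fun n => ?_
  rw [← Complex.exp_add, Equiv.coe_addRight]
  push_cast
  ring_nf

theorem jTheta1_add_half_pi_mul (z τ : ℂ) :
    jTheta1 (z + Real.pi * τ / 2) τ = I * halfPeriodFactor z τ * jTheta4 z τ := by
  unfold jTheta1 jTheta4 halfPeriodFactor
  rw [← tsum_mul_left, ← tsum_mul_left, ← (Equiv.addRight (1 : ℤ)).tsum_eq (fun n : ℤ =>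
    I * Complex.exp _ * _)]
  refine tsum_congr fun n => ?_
  rw [Equiv.coe_addRight, zpow_add_one₀ (by norm_num), mul_assoc I,
    mul_left_comm (Complex.exp _), ← Complex.exp_add]
  push_cast
  ring_nf

theorem halfPeriodFactor_mul_neg_sub (z τ : ℂ) :
    halfPeriodFactor (-z) τ * halfPeriodFactor (z - Real.pi * τ / 2) τ = 1 := by
  rw [halfPeriodFactor, halfPeriodFactor, ← Complex.exp_add, Complex.exp_eq_one_iff]
  exact ⟨0, by push_cast; ring⟩

theorem jTheta1_sub_half_pi_mul (z τ : ℂ) :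
    jTheta1 (z - Real.pi * τ / 2) τ = -I * halfPeriodFactor (-z) τ * jTheta4 z τ := by
  have h := jTheta4_add_half_pi_mul (z - Real.pi * τ / 2) τ
  rw [sub_add_cancel] at h
  rw [h]
  linear_combination (I * I * jTheta1 (z - Real.pi * τ / 2) τ) * halfPeriodFactor_mul_neg_sub z τ +
    jTheta1 (z - Real.pi * τ / 2) τ * I_mul_I

theorem jTheta4_sub_half_pi_mul (z τ : ℂ) :
    jTheta4 (z - Real.pi * τ / 2) τ = -I * halfPeriodFactor (-z) τ * jTheta1 z τ := by
  have h := jTheta1_add_half_pi_mul (z - Real.pi * τ / 2) τ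
  rw [sub_add_cancel] at h
  rw [h]
  linear_combination (I * I * jTheta4 (z - Real.pi * τ / 2) τ) * halfPeriodFactor_mul_neg_sub z τ +
    jTheta4 (z - Real.pi * τ / 2) τ * I_mul_I

theorem jTheta2_sub_half_pi_mul (z τ : ℂ) :
    jTheta2 (z - Real.pi * τ / 2) τ = halfPeriodFactor (-z) τ * jTheta3 z τ := by
  have h := jTheta3_add_half_pi_mul (z - Real.pi * τ / 2) τ
  rw [sub_add_cancel] at h
  rw [h, ← mul_assoc, halfPeriodFactor_mul_neg_sub, one_mul]

theorem jTheta3_sub_half_pi_mul (z τ : ℂ) :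
    jTheta3 (z - Real.pi * τ / 2) τ = halfPeriodFactor (-z) τ * jTheta2 z τ := by
  have h := jTheta2_add_half_pi_mul (z - Real.pi * τ / 2) τ
  rw [sub_add_cancel] at h
  rw [h, ← mul_assoc, halfPeriodFactor_mul_neg_sub, one_mul]

theorem jTheta3_add_pi (z τ : ℂ) : jTheta3 (z + Real.pi) τ = jTheta3 z τ := by
  rw [← jTheta4_add_half_pi z, ← jTheta3_add_half_pi, add_assoc, add_halves]

theorem jTheta3_add_pi_mul (z τ : ℂ) : jTheta3 (z + Real.pi * τ) τ =
    (Complex.exp (Real.pi * I * τ))⁻¹ * Complex.exp (-2 * I * z) * jTheta3 z τ := by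
  rw [← add_halves (Real.pi * τ : ℂ), ← add_assoc, jTheta3_add_half_pi_mul,
    jTheta2_add_half_pi_mul, ← mul_assoc, halfPeriodFactor, halfPeriodFactor, ← Complex.exp_add,
    ← Complex.exp_neg, ← Complex.exp_add]
  ring_nf

/-- quasi-periodicity of `ψ₃` with respect to `π` and `πτ`. -/
theorem psi3_quasi_periodic (τ : ℂ) (hτ : 0 < τ.im) (b c d : ℂ)
    (ψ₃ : ℂ → ℂ)
    (hψ₃ : ∀ a : ℂ, ψ₃ a =
      2 * (jTheta3 a τ * jTheta3 b τ * jTheta3 c τ * jTheta3 d τ) +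
        jTheta1 ((-a + b + c + d) / 2) τ * jTheta1 ((a - b + c + d) / 2) τ *
          jTheta1 ((a + b - c + d) / 2) τ * jTheta1 ((a + b + c - d) / 2) τ -
        jTheta2 ((-a + b + c + d) / 2) τ * jTheta2 ((a - b + c + d) / 2) τ *
          jTheta2 ((a + b - c + d) / 2) τ * jTheta2 ((a + b + c - d) / 2) τ -
        jTheta3 ((-a + b + c + d) / 2) τ * jTheta3 ((a - b + c + d) / 2) τ *
          jTheta3 ((a + b - c + d) / 2) τ * jTheta3 ((a + b + c - d) / 2) τ -
        jTheta4 ((-a + b + c + d) / 2) τ * jTheta4 ((a - b + c + d) / 2) τ *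
          jTheta4 ((a + b - c + d) / 2) τ * jTheta4 ((a + b + c - d) / 2) τ) :
    (∀ a : ℂ, ψ₃ (a + Real.pi) = ψ₃ a) ∧
    (∀ a : ℂ, ψ₃ (a + Real.pi * τ) =
        (Complex.exp (Real.pi * I * τ))⁻¹ * Complex.exp (-2 * I * a) * ψ₃ a) := by
  constructor
  · intro a
    rw [hψ₃, hψ₃, jTheta3_add_pi,
      show (-(a + Real.pi) + b + c + d) / 2 = (-a + b + c + d) / 2 - Real.pi / 2 by ring,
      show (a + Real.pi - b + c + d) / 2 = (a - b + c + d) / 2 + Real.pi / 2 by ring,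
      show (a + Real.pi + b - c + d) / 2 = (a + b - c + d) / 2 + Real.pi / 2 by ring,
      show (a + Real.pi + b + c - d) / 2 = (a + b + c - d) / 2 + Real.pi / 2 by ring]
    simp only [jTheta1_add_half_pi, jTheta2_add_half_pi, jTheta3_add_half_pi,
      jTheta4_add_half_pi, jTheta1_sub_half_pi, jTheta2_sub_half_pi, jTheta3_sub_half_pi,
      jTheta4_sub_half_pi]
    ring
  · intro a
    have hF : halfPeriodFactor (-((-a + b + c + d) / 2)) τ *
        halfPeriodFactor ((a - b + c + d) / 2) τ * halfPeriodFactor ((a + b - c + d) / 2) τ *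
        halfPeriodFactor ((a + b + c - d) / 2) τ =
        (Complex.exp (Real.pi * I * τ))⁻¹ * Complex.exp (-2 * I * a) := by
      simp only [halfPeriodFactor, ← Complex.exp_add, ← Complex.exp_neg]
      ring_nf
    rw [hψ₃, hψ₃, jTheta3_add_pi_mul,
      show (-(a + Real.pi * τ) + b + c + d) / 2 = (-a + b + c + d) / 2 - Real.pi * τ / 2 by ring,
      show (a + Real.pi * τ - b + c + d) / 2 = (a - b + c + d) / 2 + Real.pi * τ / 2 by ring,
      show (a + Real.pi * τ + b - c + d) / 2 = (a + b - c + d) / 2 + Real.pi * τ / 2 by ring,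
      show (a + Real.pi * τ + b + c - d) / 2 = (a + b + c - d) / 2 + Real.pi * τ / 2 by ring]
    simp only [jTheta1_add_half_pi_mul, jTheta2_add_half_pi_mul, jTheta3_add_half_pi_mul,
      jTheta4_add_half_pi_mul, jTheta1_sub_half_pi_mul, jTheta2_sub_half_pi_mul,
      jTheta3_sub_half_pi_mul, jTheta4_sub_half_pi_mul, ← hF]
    ring_nf
    simp only [I_pow_four]
    ring
end
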